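/- Under assumptions (A1)–(A4) as in the previous theorem, for each fixed $k\in\mathbb{N}_0$ and any positive sequence $c(n)$ with $c(n)\to0$, $nc(n)\to\infty$: $\mu_{\hat T^k H}(Z_n^Y/n\le c(n))\sim \frac{\sin(\pi\alpha)}{\pi\alpha}\frac{c(n)^\alpha\ell(n)}{\ell(c(n)n)}$ as $n\to\infty$. -/

import Mathlib

open MeasureTheory Filter Real Set
open scoped Topology ENNReal

/-- First return time to `Y` (value `⊤` if the orbit never returns). -/
noncomputable def firstReturn {X : Type*} (T : X → X) (Y : Set X) (x : X) : ℕ∞ :=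
  ⨅ (k : ℕ) (_ : 1 ≤ k ∧ T^[k] x ∈ Y), (k : ℕ∞)

/-- The sets `Y₀ = Y`, `Yₙ = Yᶜ ∩ {φ = n}`. -/
noncomputable def Ypart {X : Type*} (T : X → X) (Y : Set X) : ℕ → Set X
  | 0 => Y
  | (n+1) => Yᶜ ∩ {x | firstReturn T Y x = ((n+1 : ℕ) : ℕ∞)}

/-- The wandering rate `w_n^Y`. -/
noncomputable def wrate {X : Type*} [MeasurableSpace X] (T : X → X) (Y : Set X)
    (μ : Measure X) (n : ℕ) : ℝ≥0∞ :=
  ∑ k ∈ Finset.range n, μ (Y ∩ {x | (k : ℕ∞) < firstReturn T Y x})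

/-- The normalized entrance densities `(w_n^Y)⁻¹ ∑_{k<n} T̂^k 1_{Y_k}`. -/
noncomputable def entrance {X : Type*} [MeasurableSpace X] (T : X → X) (Y : Set X)
    (μ : Measure X) (hatT : (X → ℝ≥0∞) → (X → ℝ≥0∞)) (n : ℕ) (x : X) : ℝ≥0∞ :=
  (∑ k ∈ Finset.range n, (hatT^[k] ((Ypart T Y k).indicator fun _ => (1:ℝ≥0∞))) x) /
    wrate T Y μ n

/-- Last visit time to `Y` up to time `n` (with `max ∅ = 0`). -/
noncomputable def lastVisit {X : Type*} (T : X → X) (Y : Set X) (n : ℕ) (x : X) : ℕ :=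
  sSup {k | k ≤ n ∧ T^[k] x ∈ Y}


/-- Additive uniform convergence theorem. -/
lemma uct_add (f : ℝ → ℝ) (hf : Measurable f)
    (hsv : ∀ v : ℝ, Tendsto (fun t => f (t + v) - f t) atTop (𝓝 0))
    (x y : ℕ → ℝ) (hx : Tendsto x atTop atTop) (hxy : Tendsto (fun n => y n - x n) atTop (𝓝 0)) :
    Tendsto (fun n => f (y n) - f (x n)) atTop (𝓝 0) := by
  have hy : Tendsto y atTop atTop := by
    have := hxy.add_atTop hx
    simpa using this
  have key : ∀ z : ℕ → ℝ, Tendsto z atTop atTop → Tendsto (fun n => ∫ v in Set.Icc (0:ℝ) 4,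
      min 1 |f (z n + v) - f (z n)|) atTop (𝓝 0) := by
    intro z hz
    have : Tendsto (fun n => ∫ v in Set.Icc (0:ℝ) 4,
      min 1 |f (z n + v) - f (z n)|) atTop (𝓝 (∫ v in Set.Icc (0:ℝ) 4, (0:ℝ))) := by
      apply tendsto_integral_of_dominated_convergence (fun _ => (1:ℝ))
      · intro n
        apply Measurable.aestronglyMeasurable
        fun_prop
      · exact integrable_const _
      · intro n
        refine Eventually.of_forall fun v => ?_
        rw [Real.norm_eq_abs, abs_of_nonneg (by positivity)]
        exact min_le_left _ _
      · refine Eventually.of_forall fun v => ?_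
        have h1 := ((hsv v).comp hz).abs
        have h2 := (tendsto_const_nhds (x := (1:ℝ))).min h1
        simpa using h2
    simpa using this
  have hsum := (key x hx).add (key y hy)
  rw [add_zero] at hsum
  have hle : ∀ᶠ n in atTop, min 1 |f (y n) - f (x n)| ≤
      (∫ v in Set.Icc (0:ℝ) 4, min 1 |f (x n + v) - f (x n)|) +
      ∫ v in Set.Icc (0:ℝ) 4, min 1 |f (y n + v) - f (y n)| := by
    have h1 : ∀ᶠ n in atTop, |y n - x n| < 1 := by
      have := hxy.abs
      rw [abs_zero] at this
      exact this.eventually_lt_const one_pos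
    filter_upwards [h1] with n hn
    set u := y n - x n with hu
    rw [abs_lt] at hn
    have hIntg : ∀ a : ℝ, ∀ (s : Set ℝ), volume s ≠ ⊤ → ∀ b : ℝ,
        IntegrableOn (fun v => min 1 |f (a + v) - b|) s := by
      intro a s hs b
      apply Measure.integrableOn_of_bounded hs (M := 1)
      · apply Measurable.aestronglyMeasurable
        fun_prop
      · refine Eventually.of_forall fun v => ?_
        rw [Real.norm_eq_abs, abs_of_nonneg (by positivity)]
        exact min_le_left _ _
    have e1 : ∫ v in Set.Icc (1:ℝ) 2, min 1 |f (x n + v) - f (x n)| ≤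
        ∫ v in Set.Icc (0:ℝ) 4, min 1 |f (x n + v) - f (x n)| := by
      apply setIntegral_mono_set (hIntg _ _ (by simp) _)
      · refine Eventually.of_forall fun v => ?_
        simp only [Pi.zero_apply]; positivity
      · exact (Set.Icc_subset_Icc (by norm_num) (by norm_num)).eventuallyLE
    have e2 : ∫ v in Set.Icc (1:ℝ) 2, min 1 |f (x n + v) - f (y n)| ≤
        ∫ v in Set.Icc (0:ℝ) 4, min 1 |f (y n + v) - f (y n)| := by
      have : ∫ v in Set.Icc (1:ℝ) 2, min 1 |f (x n + v) - f (y n)| =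
          ∫ v in Set.Icc (1 - u) (2 - u), min 1 |f (y n + v) - f (y n)| := by
        rw [integral_Icc_eq_integral_Ioc, integral_Icc_eq_integral_Ioc,
          ← intervalIntegral.integral_of_le (by norm_num),
          ← intervalIntegral.integral_of_le (by linarith),
          ← intervalIntegral.integral_comp_sub_right (fun v => min 1 |f (y n + v) - f (y n)|) u]
        congr 1
        ext v
        have : y n + (v - u) = x n + v := by rw [hu]; ring
        rw [this]
      rw [this]
      apply setIntegral_mono_set (hIntg _ _ (by simp) _)
      · refine Eventually.of_forall fun v => ?_
        simp only [Pi.zero_apply]; positivity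
      · exact (Set.Icc_subset_Icc (by linarith) (by linarith)).eventuallyLE
    calc min 1 |f (y n) - f (x n)| = ∫ v in Set.Icc (1:ℝ) 2, min 1 |f (y n) - f (x n)| := by
          simp; norm_num
      _ ≤ ∫ v in Set.Icc (1:ℝ) 2,
          (min 1 |f (x n + v) - f (x n)| + min 1 |f (x n + v) - f (y n)|) := by
          apply integral_mono_of_nonneg
          · refine Eventually.of_forall fun v => ?_
            simp only [Pi.zero_apply]; positivity
          · exact (hIntg _ _ (by simp) _).add (hIntg _ _ (by simp) _)
          · refine Eventually.of_forall fun v => ?_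
            simp only
            have := abs_sub_le (f (y n)) (f (x n + v)) (f (x n))
            rw [abs_sub_comm (f (y n)) (f (x n + v))] at this
            have a1 := abs_nonneg (f (x n + v) - f (y n))
            have a2 := abs_nonneg (f (x n + v) - f (x n))
            rcases min_cases 1 |f (x n + v) - f (x n)| with h | h <;>
            rcases min_cases 1 |f (x n + v) - f (y n)| with h' | h' <;>
            rcases min_cases 1 |f (y n) - f (x n)| with h'' | h'' <;> linarith
      _ = _ := integral_add (hIntg _ _ (by simp) _) (hIntg _ _ (by simp) _)
      _ ≤ _ := add_le_add e1 e2
  have hmin : Tendsto (fun n => min 1 |f (y n) - f (x n)|) atTop (𝓝 0) :=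
    tendsto_of_tendsto_of_tendsto_of_le_of_le' tendsto_const_nhds hsum
      (Eventually.of_forall fun n => by positivity) hle
  rw [tendsto_zero_iff_abs_tendsto_zero]
  refine hmin.congr' ?_
  filter_upwards [hmin.eventually_lt_const one_pos] with n hn
  rcases min_cases 1 |f (y n) - f (x n)| with h | h
  · rw [h.1] at hn; exact absurd hn (lt_irrefl _)
  · exact h.1

/-- Uniform convergence theorem for slowly varying functions. -/
lemma sv_uct (ℓ : ℝ → ℝ) (hℓmeas : Measurable ℓ) (hℓpos : ∀ t, 0 < t → 0 < ℓ t)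
    (hℓsv : ∀ lam : ℝ, 0 < lam → Tendsto (fun t => ℓ (lam * t) / ℓ t) atTop (𝓝 1))
    (x y : ℕ → ℝ) (hx : Tendsto x atTop atTop)
    (hxy : Tendsto (fun n => y n / x n) atTop (𝓝 1)) :
    Tendsto (fun n => ℓ (y n) / ℓ (x n)) atTop (𝓝 1) := by
  have h := uct_add (fun s => Real.log (ℓ (Real.exp s))) (by fun_prop) ?_
    (fun n => Real.log (x n)) (fun n => Real.log (y n)) (Real.tendsto_log_atTop.comp hx) ?_
  · have h2 := (Real.continuous_exp.tendsto 0).comp h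
    rw [Real.exp_zero] at h2
    refine h2.congr' ?_
    filter_upwards [hx.eventually_gt_atTop 0, hxy.eventually_const_lt one_pos] with n h1 h3
    have hy : 0 < y n := by
      rcases div_pos_iff.1 h3 with h | h
      · exact h.1
      · linarith [h.2]
    simp only [Function.comp]
    rw [Real.exp_log h1, Real.exp_log hy, Real.exp_sub, Real.exp_log (hℓpos _ hy),
      Real.exp_log (hℓpos _ h1)]
  · intro v
    have h1 := ((Real.continuousAt_log one_ne_zero).tendsto.comp (hℓsv (Real.exp v) (Real.exp_pos v))).comp
      Real.tendsto_exp_atTop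
    rw [Real.log_one] at h1
    refine h1.congr fun t => ?_
    simp only [Function.comp]
    rw [Real.log_div (hℓpos _ (by positivity)).ne' (hℓpos _ (by positivity)).ne', Real.exp_add,
      mul_comm]
  · have h1 := (Real.continuousAt_log one_ne_zero).tendsto.comp hxy
    rw [Real.log_one] at h1
    refine h1.congr' ?_
    filter_upwards [hx.eventually_gt_atTop 0, hxy.eventually_const_lt one_pos] with n h1 h3
    have hy : 0 < y n := by
      rcases div_pos_iff.1 h3 with h | h
      · exact h.1
      · linarith [h.2]
    simp only [Function.comp]
    rw [Real.log_div hy.ne' h1.ne']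

/-- Regular variation of the partial sums. -/
lemma w_ratio (α : ℝ)
    (ℓ : ℝ → ℝ) (hℓmeas : Measurable ℓ) (hℓpos : ∀ t, 0 < t → 0 < ℓ t)
    (hℓsv : ∀ lam : ℝ, 0 < lam → Tendsto (fun t => ℓ (lam * t) / ℓ t) atTop (𝓝 1))
    (w : ℕ → ℝ) (hw : Tendsto (fun n : ℕ => w n / ((n : ℝ) ^ (1 - α) * ℓ n)) atTop (𝓝 1))
    (a b : ℕ → ℕ) (t : ℝ) (ht : 0 < t) (hb : Tendsto b atTop atTop)
    (hab : Tendsto (fun n => (a n : ℝ) / b n) atTop (𝓝 t)) :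
    Tendsto (fun n => w (a n) / w (b n)) atTop (𝓝 (t ^ (1 - α))) := by
  have hbR : Tendsto (fun n => (b n : ℝ)) atTop atTop := tendsto_natCast_atTop_atTop.comp hb
  have haR : Tendsto (fun n => (a n : ℝ)) atTop atTop := by
    have := hab.pos_mul_atTop ht hbR
    refine this.congr' ?_
    filter_upwards [hbR.eventually_gt_atTop 0] with n hn
    field_simp
  have ha : Tendsto a atTop atTop := tendsto_natCast_atTop_iff.1 haR
  have h1 := (hw.comp ha).div (hw.comp hb) one_ne_zero
  have h2 : Tendsto (fun n => ((a n : ℝ) / b n) ^ (1 - α)) atTop (𝓝 (t ^ (1-α))) :=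
    hab.rpow_const (Or.inl ht.ne')
  have htb : Tendsto (fun n => t * (b n : ℝ)) atTop atTop := hbR.const_mul_atTop ht
  have h3 := sv_uct ℓ hℓmeas hℓpos hℓsv (fun n => t * (b n : ℝ)) (fun n => (a n : ℝ)) htb (by
    have := hab.div_const t
    rw [div_self ht.ne'] at this
    refine this.congr fun n => ?_
    rw [div_div, mul_comm])
  have h4 := (hℓsv t ht).comp hbR
  have h5 := ((h1.mul h2).mul h3).mul h4
  simp only [div_one, one_mul, mul_one] at h5
  refine h5.congr' ?_
  filter_upwards [hbR.eventually_gt_atTop 0, haR.eventually_gt_atTop 0] with n hbn han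
  have q1 := hℓpos _ hbn
  have q2 := hℓpos _ han
  have q3 := hℓpos _ (mul_pos ht hbn)
  simp only [Function.comp, Pi.div_apply]
  rw [Real.div_rpow han.le hbn.le]
  have q4 := Real.rpow_pos_of_pos hbn (1 - α)
  have q5 := Real.rpow_pos_of_pos han (1 - α)
  by_cases hwb : w (b n) = 0
  · simp [hwb]
  field_simp

lemma sum_upper (q : ℕ → ℝ) (hq : Antitone q) (n d : ℕ) :
    ∑ k ∈ Finset.range (n + d), q k ≤ ∑ k ∈ Finset.range n, q k + d * q n := by
  induction d with
  | zero => simp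
  | succ d ih =>
    rw [← add_assoc, Finset.sum_range_succ]
    push_cast
    have := hq (Nat.le_add_right n d)
    linarith

lemma sum_lower (q : ℕ → ℝ) (hq : Antitone q) (n d : ℕ) :
    ∑ k ∈ Finset.range n, q k + d * q (n + d) ≤ ∑ k ∈ Finset.range (n + d), q k := by
  rw [Finset.sum_range_add]
  have : ∑ k ∈ Finset.range d, q (n + d) ≤ ∑ x ∈ Finset.range d, q (n + x) := by
    apply Finset.sum_le_sum
    intro i hi
    exact hq (by simp at hi; omega)
  simp at this
  linarith

/-- Monotone density theorem. -/
lemma mono_density (α : ℝ)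
    (q : ℕ → ℝ) (hq : Antitone q) (w : ℕ → ℝ) (hwq : ∀ n, w n = ∑ k ∈ Finset.range n, q k)
    (hwpos : ∀ n, 0 < n → 0 < w n)
    (hr : ∀ (a b : ℕ → ℕ) (t : ℝ), 0 < t → Tendsto b atTop atTop →
      Tendsto (fun n => (a n : ℝ) / b n) atTop (𝓝 t) →
      Tendsto (fun n => w (a n) / w (b n)) atTop (𝓝 (t ^ (1 - α)))) :
    Tendsto (fun n : ℕ => n * q n / w n) atTop (𝓝 (1 - α)) := by
  have hd : HasDerivAt (fun t : ℝ => t ^ (1 - α)) (1 - α) 1 := by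
    have := Real.hasDerivAt_rpow_const (x := 1) (p := 1 - α) (Or.inl one_ne_zero)
    simpa using this
  rw [hasDerivAt_iff_tendsto_slope] at hd
  have hfl : ∀ t : ℝ, 0 < t → Tendsto (fun n : ℕ => ((⌊t * n⌋₊ : ℕ) : ℝ) / n) atTop (𝓝 t) := by
    intro t ht
    exact (tendsto_nat_floor_mul_div_atTop ht.le).comp tendsto_natCast_atTop_atTop
  have hl : ∀ t : ℝ, 0 < t → t ≠ 1 → Tendsto (fun n : ℕ => (w ⌊t * n⌋₊ / w n - 1) /
      (((⌊t * n⌋₊ : ℕ) : ℝ) / n - 1)) atTop (𝓝 (slope (fun t : ℝ => t ^ (1 - α)) 1 t)) := by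
    intro t ht ht1
    have h1 := hr (fun n => ⌊t * n⌋₊) id t ht tendsto_id (hfl t ht)
    have := (h1.sub_const 1).div ((hfl t ht).sub_const 1) (sub_ne_zero.2 ht1)
    rw [slope_def_field, Real.one_rpow]
    exact this
  rw [tendsto_order]
  constructor
  · intro c hc
    have h1 : ∀ᶠ t in 𝓝[>] (1:ℝ), c < slope (fun t : ℝ => t ^ (1 - α)) 1 t :=
      (hd.mono_left (nhdsWithin_mono _ fun x hx => ne_of_gt hx)).eventually_const_lt hc
    obtain ⟨t, htc, ht1⟩ := (h1.and self_mem_nhdsWithin).exists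
    have ht1 : 1 < t := ht1
    filter_upwards [(hl t (by linarith) ht1.ne').eventually_const_lt htc,
      (hfl t (by linarith)).eventually_const_lt ht1, eventually_gt_atTop 0] with n h2 h3 hn
    refine h2.trans_le ?_
    have hn' : (0:ℝ) < n := by exact_mod_cast hn
    have hlt : n < ⌊t * n⌋₊ := by
      rw [lt_div_iff₀ hn', one_mul] at h3
      exact_mod_cast h3
    obtain ⟨d, hd'⟩ := Nat.exists_eq_add_of_lt hlt
    rw [hd'] at h3 ⊢
    have := sum_upper q hq n (d + 1)
    rw [← hwq, ← hwq] at this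
    rw [← add_assoc] at this
    have hwn := hwpos n hn
    rw [div_le_iff₀ (by linarith)]
    push_cast at this ⊢
    have e : (n:ℝ) * q n / w n * (((n:ℝ) + d + 1) / n - 1) = ((d:ℝ)+1) * q n / w n := by
      field_simp; ring
    rw [e, sub_le_iff_le_add, div_le_iff₀ hwn]
    have e2 : (((d:ℝ)+1) * q n / w n + 1) * w n = ((d:ℝ)+1) * q n + w n := by field_simp
    rw [e2]; linarith
  · intro c hc
    have h1 : ∀ᶠ t in 𝓝[<] (1:ℝ), slope (fun t : ℝ => t ^ (1 - α)) 1 t < c :=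
      (hd.mono_left (nhdsWithin_mono _ fun x hx => ne_of_lt hx)).eventually_lt_const hc
    have h0 : ∀ᶠ t in 𝓝[<] (1:ℝ), (0:ℝ) < t :=
      nhdsWithin_le_nhds (lt_mem_nhds one_pos)
    obtain ⟨t, ⟨htc, ht0⟩, ht1⟩ := ((h1.and h0).and self_mem_nhdsWithin).exists
    have ht1 : t < 1 := ht1
    filter_upwards [(hl t ht0 ht1.ne).eventually_lt_const htc,
      (hfl t ht0).eventually_lt_const ht1, eventually_gt_atTop 0] with n h2 h3 hn
    refine lt_of_le_of_lt ?_ h2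
    have hn' : (0:ℝ) < n := by exact_mod_cast hn
    have hlt : ⌊t * n⌋₊ < n := by
      rw [div_lt_iff₀ hn', one_mul] at h3
      exact_mod_cast h3
    set m := ⌊t * n⌋₊ with hm
    obtain ⟨d, hd'⟩ := Nat.exists_eq_add_of_lt hlt
    have := sum_lower q hq m (d + 1)
    rw [← hwq, ← hwq, ← add_assoc, ← hd'] at this
    have hwn := hwpos n hn
    rw [le_div_iff_of_neg (by linarith)]
    have hnd : (n:ℝ) = m + d + 1 := by exact_mod_cast hd'
    push_cast at this ⊢
    have e : (n:ℝ) * q n / w n * ((m:ℝ) / n - 1) = -(((d:ℝ)+1) * q n / w n) := by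
      field_simp
      rw [hnd]; ring
    rw [e]
    have e2 : w m / w n - 1 + ((d:ℝ)+1) * q n / w n = (w m + (d+1) * q n - w n) / w n := by
      field_simp; ring
    have : (w m + (d+1) * q n - w n) / w n ≤ 0 := div_nonpos_of_nonpos_of_nonneg (by linarith) hwn.le
    linarith

lemma w_mul_le (q : ℕ → ℝ) (hq : Antitone q) (d m : ℕ) :
    ∑ k ∈ Finset.range (d * m), q k ≤ d * ∑ k ∈ Finset.range m, q k := by
  induction d with
  | zero => simp
  | succ d ih =>
    rw [Nat.succ_mul, Finset.sum_range_add]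
    have : ∑ x ∈ Finset.range m, q (d * m + x) ≤ ∑ x ∈ Finset.range m, q x :=
      Finset.sum_le_sum fun i _ => hq (by omega)
    push_cast
    linarith

lemma integral_floor (f : ℕ → ℝ) (hf : IntegrableOn (fun t : ℝ => f ⌊t⌋₊) (Set.Ioi 0)) :
    ∫ t in Set.Ioi (0:ℝ), f ⌊t⌋₊ = ∑' n, f n := by
  have hU : (⋃ n : ℕ, Set.Ico (n:ℝ) (n+1)) = Set.Ici 0 := by
    ext t
    simp only [Set.mem_iUnion, Set.mem_Ico, Set.mem_Ici]
    constructor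
    · rintro ⟨n, hn, _⟩
      exact le_trans (Nat.cast_nonneg n) hn
    · intro ht
      exact ⟨⌊t⌋₊, Nat.floor_le ht, Nat.lt_floor_add_one t⟩
  rw [← integral_Ici_eq_integral_Ioi, ← hU, integral_iUnion]
  · congr 1
    ext n
    have : ∫ t in Set.Ico (n:ℝ) (n+1), f ⌊t⌋₊ = ∫ t in Set.Ico (n:ℝ) (n+1), f n := by
      apply setIntegral_congr_fun measurableSet_Ico
      intro t ht
      have : ⌊t⌋₊ = n := by
        rw [Nat.floor_eq_iff (le_trans (Nat.cast_nonneg n) ht.1)]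
        exact ht
      simp only [this]
    rw [this]
    simp
  · intro n; exact measurableSet_Ico
  · intro i j hij
    rw [Function.onFun, Set.disjoint_left]
    intro t h1 h2
    apply hij
    have a1 : (i:ℝ) < j + 1 := lt_of_le_of_lt h1.1 h2.2
    have a2 : (j:ℝ) < i + 1 := lt_of_le_of_lt h2.1 h1.2
    have a3 : i < j + 1 := by exact_mod_cast a1
    have a4 : j < i + 1 := by exact_mod_cast a2
    omega
  · rw [hU]
    exact (integrableOn_Ici_iff_integrableOn_Ioi).2 hf

/-- Abelian part. -/
lemma abelian (α : ℝ) (hα : α ∈ Set.Ioo (0:ℝ) 1)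
    (q : ℕ → ℝ) (hq : Antitone q) (hq0 : ∀ n, 0 ≤ q n)
    (w : ℕ → ℝ) (hwq : ∀ n, w n = ∑ k ∈ Finset.range n, q k)
    (hwpos : ∀ n, 0 < n → 0 < w n)
    (hr : ∀ (a b : ℕ → ℕ) (t : ℝ), 0 < t → Tendsto b atTop atTop →
      Tendsto (fun n => (a n : ℝ) / b n) atTop (𝓝 t) →
      Tendsto (fun n => w (a n) / w (b n)) atTop (𝓝 (t ^ (1 - α))))
    (lam : ℝ) (hl : 0 < lam) :
    Tendsto (fun m : ℕ => (∑' n, w (n + 1) * (Real.exp (-(lam / m))) ^ n) / (m * w m)) atTop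
      (𝓝 (Real.Gamma (2 - α) * lam ^ (-(2 - α)))) := by
  have hwmono : Monotone w := by
    refine monotone_nat_of_le_succ fun n => ?_
    rw [hwq, hwq, Finset.sum_range_succ]
    linarith [hq0 n]
  have hw0 : ∀ n, 0 ≤ w n := fun n => by rw [hwq]; exact Finset.sum_nonneg fun i _ => hq0 i
  let G : ℕ → ℝ → ℝ := fun m t => w (⌊t * m⌋₊ + 1) / w m * (Real.exp (-(lam / m))) ^ ⌊t * m⌋₊
  let B : ℝ → ℝ := fun t => Real.exp lam *
    (t ^ (1:ℝ) * Real.exp (-lam * t ^ (1:ℝ)) + t ^ (0:ℝ) * Real.exp (-lam * t ^ (1:ℝ)))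
  have hG0 : ∀ m t, 0 ≤ G m t := by
    intro m t
    have := hw0 m
    have := hw0 (⌊t * m⌋₊ + 1)
    simp only [G]; positivity
  have hGm : ∀ m, Measurable (G m) := by
    intro m
    have h1 : Measurable (fun k : ℕ => w (k + 1) / w m * (Real.exp (-(lam / m))) ^ k) :=
      measurable_of_countable _
    exact h1.comp (Nat.measurable_floor.comp (measurable_id.mul_const _))
  have hBint : IntegrableOn B (Set.Ioi 0) := by
    apply Integrable.const_mul
    exact (integrableOn_rpow_mul_exp_neg_mul_rpow (by norm_num) one_pos hl).add
      (integrableOn_rpow_mul_exp_neg_mul_rpow (by norm_num) one_pos hl)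
  have hGB : ∀ m : ℕ, 0 < m → ∀ t : ℝ, 0 < t → G m t ≤ B t := by
    intro m hm t ht
    have hm' : (0:ℝ) < m := by exact_mod_cast hm
    have hm1 : (1:ℝ) ≤ m := by exact_mod_cast hm
    have hk : ((⌊t * m⌋₊ : ℕ) : ℝ) ≤ t * m := Nat.floor_le (by positivity)
    have hk2 := Nat.lt_floor_add_one (t * m)
    set k := ⌊t * m⌋₊
    have h1 : w (k + 1) ≤ (t + 1) * w m := by
      have : w (k + 1) ≤ w ((k / m + 1) * m) := by
        apply hwmono
        have := Nat.lt_div_mul_add hm (a := k)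
        rw [add_mul, one_mul]
        omega
      refine this.trans ?_
      rw [hwq, hwq]
      refine (w_mul_le q hq _ _).trans ?_
      rw [← hwq]
      apply mul_le_mul_of_nonneg_right _ (hw0 m)
      push_cast
      have : ((k / m : ℕ) : ℝ) ≤ (k:ℝ) / m := Nat.cast_div_le
      have h3 : (k:ℝ)/m ≤ t := by rw [div_le_iff₀ hm']; exact hk
      linarith
    have h2 : w (k + 1) / w m ≤ t + 1 := by rw [div_le_iff₀ (hwpos m hm)]; exact h1
    have h3 : (Real.exp (-(lam / m))) ^ k ≤ Real.exp lam * Real.exp (-lam * t) := by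
      rw [← Real.exp_nat_mul, ← Real.exp_add, Real.exp_le_exp]
      have : t - 1 ≤ k / m := by
        rw [le_div_iff₀ hm']
        nlinarith
      have e : (k:ℝ) * -(lam / m) = - (lam * (k/m)) := by ring
      rw [e]
      nlinarith
    calc G m t ≤ (t + 1) * (Real.exp lam * Real.exp (-lam * t)) :=
          mul_le_mul h2 h3 (by positivity) (by positivity)
      _ = B t := by simp only [B, Real.rpow_one, Real.rpow_zero]; ring
  have hGint : ∀ m : ℕ, 0 < m → IntegrableOn (G m) (Set.Ioi 0) := by
    intro m hm
    refine Integrable.mono' hBint (hGm m).aestronglyMeasurable ?_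
    filter_upwards [ae_restrict_mem measurableSet_Ioi] with t ht
    rw [Real.norm_eq_abs, abs_of_nonneg (hG0 m t)]
    exact hGB m hm t ht
  have hlim : Tendsto (fun m => ∫ t in Set.Ioi (0:ℝ), G m t) atTop
      (𝓝 (∫ t in Set.Ioi (0:ℝ), t ^ (1 - α) * Real.exp (-lam * t))) := by
    apply tendsto_integral_filter_of_dominated_convergence B
    · exact Eventually.of_forall fun m => (hGm m).aestronglyMeasurable
    · filter_upwards [eventually_gt_atTop 0] with m hm
      filter_upwards [ae_restrict_mem measurableSet_Ioi] with t ht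
      rw [Real.norm_eq_abs, abs_of_nonneg (hG0 m t)]
      exact hGB m hm t ht
    · exact hBint
    · filter_upwards [ae_restrict_mem measurableSet_Ioi] with t ht
      have ht : 0 < t := ht
      have hfl : Tendsto (fun n : ℕ => ((⌊t * n⌋₊ : ℕ) : ℝ) / n) atTop (𝓝 t) :=
        (tendsto_nat_floor_mul_div_atTop ht.le).comp tendsto_natCast_atTop_atTop
      have hfl1 : Tendsto (fun n : ℕ => ((⌊t * n⌋₊ + 1 : ℕ) : ℝ) / n) atTop (𝓝 t) := by
        have := hfl.add tendsto_one_div_atTop_nhds_zero_nat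
        rw [add_zero] at this
        refine this.congr fun n => ?_
        push_cast; ring
      have h1 := hr (fun n => ⌊t * n⌋₊ + 1) id t ht tendsto_id hfl1
      have h2 := (Real.continuous_exp.tendsto _).comp (hfl.const_mul (-lam))
      refine (h1.mul h2).congr fun m => ?_
      simp only [G, Function.comp, id]
      rw [← Real.exp_nat_mul]
      congr 2
      ring
  rw [show ∫ t in Set.Ioi (0:ℝ), t ^ (1 - α) * Real.exp (-lam * t) =
      Real.Gamma (2 - α) * lam ^ (-(2 - α)) by
    have := Real.integral_rpow_mul_exp_neg_mul_Ioi (a := 2 - α) (r := lam) (by linarith [hα.2]) hl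
    rw [show (2 - α - 1) = 1 - α by ring] at this
    simp only [neg_mul]
    rw [this, one_div, Real.inv_rpow hl.le, Real.rpow_neg hl.le]
    ring] at hlim
  refine hlim.congr' ?_
  filter_upwards [eventually_gt_atTop 0] with m hm
  have hm' : (0:ℝ) < m := by exact_mod_cast hm
  have h1 := integral_comp_mul_right_Ioi
    (fun s : ℝ => w (⌊s⌋₊ + 1) / w m * (Real.exp (-(lam / m))) ^ ⌊s⌋₊) 0 hm'
  have h2 := (integrableOn_Ioi_comp_mul_right_iff
    (fun s : ℝ => w (⌊s⌋₊ + 1) / w m * (Real.exp (-(lam / m))) ^ ⌊s⌋₊) 0 hm').1 (hGint m hm)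
  rw [zero_mul] at h1 h2
  rw [integral_floor (fun k => w (k + 1) / w m * (Real.exp (-(lam / m))) ^ k) h2] at h1
  have h3 : ∫ t in Set.Ioi (0:ℝ), G m t = _ := h1
  rw [h3, smul_eq_mul]
  have : ∀ n, w (n + 1) / w m * (Real.exp (-(lam / m))) ^ n =
    (w m)⁻¹ * (w (n + 1) * (Real.exp (-(lam / m))) ^ n) := fun n => by ring
  simp_rw [this]
  rw [tsum_mul_left]
  generalize (∑' n, w (n + 1) * (Real.exp (-(lam / m))) ^ n) = S
  rw [div_eq_mul_inv, mul_inv]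
  ring

/-- A positive linear functional on continuous functions on `[0,1]`. -/
def PosFun (Λ : (ℝ → ℝ) → ℝ) : Prop :=
  (∀ f g, Continuous f → Continuous g → Λ (fun x => f x + g x) = Λ f + Λ g) ∧
  (∀ (c : ℝ) f, Continuous f → Λ (fun x => c * f x) = c * Λ f) ∧
  (∀ f g, Continuous f → Continuous g → (∀ x ∈ Set.Icc (0:ℝ) 1, f x ≤ g x) → Λ f ≤ Λ g)

lemma PosFun.near {Λ : (ℝ → ℝ) → ℝ} (h : PosFun Λ) (f g : ℝ → ℝ) (hf : Continuous f)
    (hg : Continuous g) (δ : ℝ) (hfg : ∀ x ∈ Set.Icc (0:ℝ) 1, |g x - f x| < δ) :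
    |Λ g - Λ f| ≤ δ * Λ (fun _ => 1) := by
  obtain ⟨ha, hc, hm⟩ := h
  have h1 := hm g (fun x => f x + δ * 1) hg (by fun_prop) (fun x hx => by
    have := (abs_lt.1 (hfg x hx)).2; linarith)
  have h2 := hm f (fun x => g x + δ * 1) hf (by fun_prop) (fun x hx => by
    have := (abs_lt.1 (hfg x hx)).1; linarith)
  rw [ha _ (fun x => δ * 1) hf (by fun_prop), hc δ (fun _ => 1) (by fun_prop)] at h1
  rw [ha _ (fun x => δ * 1) hg (by fun_prop), hc δ (fun _ => 1) (by fun_prop)] at h2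
  rw [abs_le]
  constructor <;> linarith

lemma PosFun.poly {Λ : ℕ → (ℝ → ℝ) → ℝ} {Λ' : (ℝ → ℝ) → ℝ} (h : ∀ j, PosFun (Λ j))
    (h' : PosFun Λ') (hmom : ∀ k : ℕ, Tendsto (fun j => Λ j (fun x => x ^ k)) atTop
      (𝓝 (Λ' (fun x => x ^ k)))) (p : Polynomial ℝ) :
    Tendsto (fun j => Λ j (fun x => p.eval x)) atTop (𝓝 (Λ' (fun x => p.eval x))) := by
  induction p using Polynomial.induction_on' with
  | add p q hp hq =>
    simp only [Polynomial.eval_add]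
    rw [h'.1 _ _ p.continuous q.continuous]
    refine (hp.add hq).congr fun j => ?_
    rw [(h j).1 _ _ p.continuous q.continuous]
  | monomial n a =>
    simp only [Polynomial.eval_monomial]
    rw [h'.2.1 _ _ (by fun_prop)]
    refine ((hmom n).const_mul a).congr fun j => ?_
    rw [(h j).2.1 _ _ (by fun_prop)]

lemma PosFun.cont {Λ : ℕ → (ℝ → ℝ) → ℝ} {Λ' : (ℝ → ℝ) → ℝ} (h : ∀ j, PosFun (Λ j))
    (h' : PosFun Λ') (hmom : ∀ k : ℕ, Tendsto (fun j => Λ j (fun x => x ^ k)) atTop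
      (𝓝 (Λ' (fun x => x ^ k)))) (f : ℝ → ℝ) (hf : Continuous f) :
    Tendsto (fun j => Λ j f) atTop (𝓝 (Λ' f)) := by
  have h1 : Tendsto (fun j => Λ j (fun _ => 1)) atTop (𝓝 (Λ' (fun _ => 1))) := by
    simpa using hmom 0
  have hnn : 0 ≤ Λ' (fun _ => 1) := by
    have := h'.2.2 (fun x => 0 * 1) (fun _ => 1) (by fun_prop) (by fun_prop) (by intro x _; norm_num)
    rw [h'.2.1 0 (fun _ => 1) (by fun_prop)] at this
    simpa using this
  set B := Λ' (fun _ => 1) with hB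
  rw [Metric.tendsto_atTop']
  intro ε hε
  obtain ⟨p, hp⟩ := exists_polynomial_near_of_continuousOn 0 1 f hf.continuousOn
    (ε / (4 * (B + 1))) (by positivity)
  have e1 : ∀ᶠ j in atTop, Λ j (fun _ => 1) < B + 1 := h1.eventually_lt_const (by linarith)
  have e2 := (Metric.tendsto_nhds.1 (PosFun.poly h h' hmom p)) (ε/4) (by positivity)
  obtain ⟨N, hN⟩ := eventually_atTop.1 (e1.and e2)
  refine ⟨N, fun j hj => ?_⟩
  obtain ⟨a1, a2⟩ := hN j hj.le
  have b1 := (h j).near f _ hf p.continuous _ hp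
  have b2 := h'.near f _ hf p.continuous _ hp
  rw [Real.dist_eq] at a2 ⊢
  have c1 : ε / (4 * (B + 1)) * Λ j (fun _ => 1) ≤ ε / 4 := by
    calc _ ≤ ε / (4 * (B + 1)) * (B + 1) := by gcongr
      _ = ε / 4 := by field_simp
  have c2 : ε / (4 * (B + 1)) * B ≤ ε / 4 := by
    calc _ ≤ ε / (4 * (B + 1)) * (B + 1) := by gcongr; linarith
      _ = ε / 4 := by field_simp
  have b1' := b1.trans c1
  have b2' := b2.trans c2
  rw [abs_le] at b1' b2'
  rw [abs_lt] at a2 ⊢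
  constructor <;> linarith [b1'.1, b1'.2, b2'.1, b2'.2, a2.1, a2.2]

/-- The ramp function. -/
noncomputable def ramp (s s' : ℝ) (x : ℝ) : ℝ :=
  (max x (Real.exp (-s')))⁻¹ * min 1 (max 0 ((x - Real.exp (-s')) / (Real.exp (-s) - Real.exp (-s'))))

lemma ramp_cont (s s' : ℝ) : Continuous (ramp s s') := by
  unfold ramp
  apply Continuous.mul
  · apply Continuous.inv₀ (by fun_prop)
    intro x
    have : 0 < max x (Real.exp (-s')) := lt_of_lt_of_le (Real.exp_pos _) (le_max_right _ _)
    exact this.ne'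
  · fun_prop

lemma ramp_bd (s s' : ℝ) (t : ℝ) :
    0 ≤ Real.exp (-t) * ramp s s' (Real.exp (-t)) ∧
    Real.exp (-t) * ramp s s' (Real.exp (-t)) ≤ 1 := by
  have hp := Real.exp_pos (-t)
  have hm : 0 < max (Real.exp (-t)) (Real.exp (-s')) := lt_of_lt_of_le hp (le_max_left _ _)
  unfold ramp
  constructor
  · positivity
  · rw [← mul_assoc]
    apply mul_le_one₀ _ (by positivity) (min_le_left _ _)
    rw [← div_eq_mul_inv, div_le_one hm]
    exact le_max_left _ _

lemma ramp_one (s s' : ℝ) (hs : s < s') (t : ℝ) (ht : t ≤ s) :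
    Real.exp (-t) * ramp s s' (Real.exp (-t)) = 1 := by
  have hp := Real.exp_pos (-t)
  have h1 : Real.exp (-s') < Real.exp (-s) := Real.exp_lt_exp.2 (by linarith)
  have h2 : Real.exp (-s) ≤ Real.exp (-t) := Real.exp_le_exp.2 (by linarith)
  unfold ramp
  rw [max_eq_left (by linarith), min_eq_left, mul_one, mul_inv_cancel₀ hp.ne']
  apply le_max_of_le_right
  rw [le_div_iff₀ (by linarith)]
  linarith

lemma ramp_zero (s s' : ℝ) (hs : s < s') (t : ℝ) (ht : s' < t) :
    Real.exp (-t) * ramp s s' (Real.exp (-t)) = 0 := by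
  have h1 : Real.exp (-s') < Real.exp (-s) := Real.exp_lt_exp.2 (by linarith)
  have h2 : Real.exp (-t) < Real.exp (-s') := Real.exp_lt_exp.2 (by linarith)
  unfold ramp
  rw [max_eq_left (a := (0:ℝ))]
  · simp
  · exact div_nonpos_of_nonpos_of_nonneg (by linarith) (by linarith)

lemma posFun_tsum (v x : ℕ → ℝ) (hv : ∀ i, 0 ≤ v i) (hx : ∀ i, x i ∈ Set.Icc (0:ℝ) 1)
    (hs : Summable v) : (∀ f, Continuous f → Summable (fun i => v i * f (x i))) ∧
    PosFun (fun f => ∑' i, v i * f (x i)) := by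
  have hsum : ∀ f : ℝ → ℝ, Continuous f → Summable (fun i => v i * f (x i)) := by
    intro f hf
    obtain ⟨C, hC⟩ := isCompact_Icc.exists_bound_of_continuousOn (s := Set.Icc (0:ℝ) 1) hf.continuousOn
    refine Summable.of_norm_bounded (hs.mul_left C) fun i => ?_
    rw [norm_mul, Real.norm_of_nonneg (hv i), mul_comm]
    exact mul_le_mul_of_nonneg_right (hC _ (hx i)) (hv i)
  refine ⟨hsum, ?_, ?_, ?_⟩
  · intro f g hf hg
    simp only [mul_add]
    exact (hsum f hf).tsum_add (hsum g hg)
  · intro c f hf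
    simp only [mul_left_comm _ c]
    exact tsum_mul_left
  · intro f g hf hg hfg
    exact (hsum f hf).tsum_le_tsum (fun i => mul_le_mul_of_nonneg_left (hfg _ (hx i)) (hv i))
      (hsum g hg)

lemma posFun_int (α : ℝ) (hα : 0 < α) :
    (∀ f : ℝ → ℝ, Continuous f → IntegrableOn
      (fun t => t ^ (α - 1) * Real.exp (-t) * f (Real.exp (-t))) (Set.Ioi 0)) ∧
    PosFun (fun f => ∫ t in Set.Ioi (0:ℝ), t ^ (α - 1) * Real.exp (-t) * f (Real.exp (-t))) := by
  have h0 : IntegrableOn (fun t : ℝ => t ^ (α - 1) * Real.exp (-t)) (Set.Ioi 0) := by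
    have := Real.GammaIntegral_convergent hα
    simpa [mul_comm] using this
  have hmem : ∀ t : ℝ, t ∈ Set.Ioi (0:ℝ) → Real.exp (-t) ∈ Set.Icc (0:ℝ) 1 := fun t ht =>
    ⟨(Real.exp_pos _).le, Real.exp_le_one_iff.2 (by have : 0 < t := ht; linarith)⟩
  have hIntg : ∀ f : ℝ → ℝ, Continuous f → IntegrableOn
      (fun t => t ^ (α - 1) * Real.exp (-t) * f (Real.exp (-t))) (Set.Ioi 0) := by
    intro f hf
    obtain ⟨C, hC⟩ := isCompact_Icc.exists_bound_of_continuousOn (s := Set.Icc (0:ℝ) 1) hf.continuousOn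
    refine Integrable.mul_bdd (c := C) h0 ?_ ?_
    · exact (hf.comp (by fun_prop)).aestronglyMeasurable
    · filter_upwards [ae_restrict_mem measurableSet_Ioi] with t ht
      exact hC _ (hmem t ht)
  refine ⟨hIntg, ?_, ?_, ?_⟩
  · intro f g hf hg
    simp only [mul_add]
    exact integral_add (hIntg f hf) (hIntg g hg)
  · intro c f hf
    simp only [mul_left_comm _ c]
    exact integral_const_mul _ _
  · intro f g hf hg hfg
    apply setIntegral_mono_on (hIntg f hf) (hIntg g hg) measurableSet_Ioi
    intro t ht
    have : 0 < t := ht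
    exact mul_le_mul_of_nonneg_left (hfg _ (hmem t ht)) (by positivity)

lemma int_ramp (α : ℝ) (hα : 0 < α) (s s' : ℝ) (hs0 : 0 < s) (hs : s < s') :
    s ^ α / α ≤ (∫ t in Set.Ioi (0:ℝ), t ^ (α - 1) * Real.exp (-t) * ramp s s' (Real.exp (-t))) ∧
    (∫ t in Set.Ioi (0:ℝ), t ^ (α - 1) * Real.exp (-t) * ramp s s' (Real.exp (-t))) ≤ s' ^ α / α := by
  have hI : ∀ r : ℝ, 0 < r → IntegrableOn (fun t : ℝ => t ^ (α - 1)) (Set.Ioc 0 r) ∧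
      ∫ t in Set.Ioc 0 r, t ^ (α - 1) = r ^ α / α := by
    intro r hr
    constructor
    · have := intervalIntegral.intervalIntegrable_rpow' (r := α - 1) (a := 0) (b := r) (by linarith)
      rwa [intervalIntegrable_iff_integrableOn_Ioc_of_le hr.le] at this
    · rw [← intervalIntegral.integral_of_le hr.le, integral_rpow (Or.inl (by linarith))]
      simp [Real.zero_rpow hα.ne']
  have hIntg := (posFun_int α hα).1 _ (ramp_cont s s')
  constructor
  · rw [← (hI s hs0).2]
    have : ∫ t in Set.Ioc 0 s, t ^ (α - 1) = ∫ t in Set.Ioc 0 s,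
        t ^ (α - 1) * Real.exp (-t) * ramp s s' (Real.exp (-t)) := by
      apply setIntegral_congr_fun measurableSet_Ioc
      intro t ht
      simp only
      rw [mul_assoc, ramp_one s s' hs t ht.2, mul_one]
    rw [this]
    apply setIntegral_mono_set hIntg
    · filter_upwards [ae_restrict_mem measurableSet_Ioi] with t ht
      have : 0 < t := ht
      rw [mul_assoc]
      exact mul_nonneg (by positivity) (ramp_bd s s' t).1
    · exact Set.Ioc_subset_Ioi_self.eventuallyLE
  · have hs'0 : 0 < s' := hs0.trans hs
    rw [← (hI s' hs'0).2]
    have : (∫ t in Set.Ioi (0:ℝ), t ^ (α - 1) * Real.exp (-t) * ramp s s' (Real.exp (-t))) =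
        ∫ t in Set.Ioc 0 s', t ^ (α - 1) * Real.exp (-t) * ramp s s' (Real.exp (-t)) := by
      apply setIntegral_eq_of_subset_of_forall_sdiff_eq_zero measurableSet_Ioi
        Set.Ioc_subset_Ioi_self
      intro t ht
      have : s' < t := by
        by_contra hh
        exact ht.2 ⟨ht.1, not_lt.1 hh⟩
      rw [mul_assoc, ramp_zero s s' hs t this, mul_zero]
    rw [this]
    apply setIntegral_mono_on (hIntg.mono_set Set.Ioc_subset_Ioi_self) (hI s' hs'0).1 measurableSet_Ioc
    intro t ht
    have : 0 < t := ht.1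
    rw [mul_assoc]
    exact mul_le_of_le_one_right (by positivity) (ramp_bd s s' t).2

/-- Karamata's Tauberian theorem, for a sequence of weight sequences. -/
lemma karamata (α A : ℝ) (hα : 0 < α) (hA : 0 < A) (v : ℕ → ℕ → ℝ) (m : ℕ → ℕ)
    (hm : ∀ j, 0 < m j)
    (hv : ∀ j i, 0 ≤ v j i) (hs : ∀ j, Summable (fun i : ℕ => v j i * Real.exp (-((i:ℝ) / m j))))
    (hmom : ∀ k : ℕ, Tendsto (fun j => ∑' i : ℕ, v j i * Real.exp (-((i:ℝ) / m j)) *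
      Real.exp (-((i:ℝ) / m j)) ^ k) atTop (𝓝 (A * ((k:ℝ) + 1) ^ (-α)))) :
    Tendsto (fun j => ∑ i ∈ Finset.range (m j + 1), v j i) atTop (𝓝 (A / Real.Gamma (α + 1))) := by
  have hG := Real.Gamma_pos_of_pos hα
  have hp1 : ∀ j, _ := fun j => posFun_tsum (fun i : ℕ => v j i * Real.exp (-((i:ℝ) / m j)))
    (fun i : ℕ => Real.exp (-((i:ℝ) / m j))) (fun i => mul_nonneg (hv j i) (Real.exp_pos _).le)
    (fun i => ⟨(Real.exp_pos _).le, Real.exp_le_one_iff.2 (by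
      have : (0:ℝ) ≤ (i:ℝ) / m j := by positivity
      linarith)⟩) (hs j)
  obtain ⟨hp2i, hp2⟩ := posFun_int α hα
  have hp3 : PosFun (fun f => (A / Real.Gamma α) * ∫ t in Set.Ioi (0:ℝ),
      t ^ (α - 1) * Real.exp (-t) * f (Real.exp (-t))) := by
    refine ⟨fun f g hf hg => ?_, fun c f hf => ?_, fun f g hf hg hfg => ?_⟩
    · have := hp2.1 f g hf hg
      simp only at this ⊢
      rw [this]; ring
    · have := hp2.2.1 c f hf
      simp only at this ⊢
      rw [this]; ring
    · exact mul_le_mul_of_nonneg_left (hp2.2.2 f g hf hg hfg) (by positivity)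
  have hcont := PosFun.cont (fun j => (hp1 j).2) hp3 (fun k => by
    convert hmom k using 2
    have := Real.integral_rpow_mul_exp_neg_mul_Ioi (a := α) (r := (k:ℝ) + 1) hα (by positivity)
    have e : ∀ t : ℝ, t ^ (α - 1) * Real.exp (-t) * Real.exp (-t) ^ k =
        t ^ (α - 1) * Real.exp (-(((k:ℝ) + 1) * t)) := by
      intro t
      rw [mul_assoc, ← Real.exp_nat_mul, ← Real.exp_add]
      congr 2
      ring
    simp only [e]
    rw [this, one_div, Real.inv_rpow (by positivity), Real.rpow_neg (by positivity)]
    field_simp)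
  have hval : ∀ s : ℝ, A / Real.Gamma α * (s ^ α / α) = A / Real.Gamma (α + 1) * s ^ α := by
    intro s
    rw [Real.Gamma_add_one hα.ne']
    field_simp
  have hG1 := Real.Gamma_pos_of_pos (show 0 < α + 1 by linarith)
  have hup : ∀ (s s' : ℝ), s < s' → 1 ≤ s → ∀ j, ∑ i ∈ Finset.range (m j + 1), v j i ≤
      ∑' i : ℕ, v j i * Real.exp (-((i:ℝ) / m j)) * ramp s s' (Real.exp (-((i:ℝ) / m j))) := by
    intro s s' hs hs1 j
    have hmj : (0:ℝ) < m j := by exact_mod_cast hm j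
    have h1 := (hp1 j).1 _ (ramp_cont s s')
    refine le_trans (le_of_eq ?_) (h1.sum_le_tsum (Finset.range (m j + 1)) fun i _ => ?_)
    · apply Finset.sum_congr rfl
      intro i hi
      rw [mul_assoc, ramp_one s s' hs _ _, mul_one]
      refine le_trans ?_ hs1
      rw [div_le_one hmj]
      have : i ≤ m j := by simp at hi; omega
      exact_mod_cast this
    · rw [mul_assoc]
      exact mul_nonneg (hv j i) (ramp_bd s s' _).1
  have hlo : ∀ (s : ℝ), s < 1 → ∀ j,
      ∑' i : ℕ, v j i * Real.exp (-((i:ℝ) / m j)) * ramp s 1 (Real.exp (-((i:ℝ) / m j))) ≤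
      ∑ i ∈ Finset.range (m j + 1), v j i := by
    intro s hs j
    have hmj : (0:ℝ) < m j := by exact_mod_cast hm j
    rw [tsum_eq_sum (s := Finset.range (m j + 1))]
    · apply Finset.sum_le_sum
      intro i hi
      rw [mul_assoc]
      exact mul_le_of_le_one_right (hv j i) (ramp_bd s 1 _).2
    · intro i hi
      rw [mul_assoc, ramp_zero s 1 hs _ _, mul_zero]
      rw [lt_div_iff₀ hmj, one_mul]
      have : m j < i := by simp at hi; omega
      exact_mod_cast this
  have hpow : Tendsto (fun s : ℝ => A / Real.Gamma (α + 1) * s ^ α) (𝓝 1)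
      (𝓝 (A / Real.Gamma (α + 1))) := by
    have : ContinuousAt (fun s : ℝ => A / Real.Gamma (α + 1) * s ^ α) 1 :=
      continuousAt_const.mul (Real.continuousAt_rpow_const _ _ (Or.inl one_ne_zero))
    have h := this.tendsto
    simpa using h
  rw [tendsto_order]
  constructor
  · intro c hc
    have h1 : ∀ᶠ s in 𝓝[<] (1:ℝ), c < A / Real.Gamma (α + 1) * s ^ α :=
      (hpow.mono_left nhdsWithin_le_nhds).eventually_const_lt hc
    have h0 : ∀ᶠ t in 𝓝[<] (1:ℝ), (0:ℝ) < t := nhdsWithin_le_nhds (lt_mem_nhds one_pos)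
    obtain ⟨s, ⟨hsc, hs0⟩, hs1⟩ := ((h1.and h0).and self_mem_nhdsWithin).exists
    have hs1 : s < 1 := hs1
    have h2 := hcont _ (ramp_cont s 1)
    have h3 := mul_le_mul_of_nonneg_left (int_ramp α hα s 1 hs0 hs1).1
      (show 0 ≤ A / Real.Gamma α by positivity)
    rw [hval] at h3
    filter_upwards [h2.eventually_const_lt (hsc.trans_le h3)] with j hj
    exact hj.trans_le (hlo s hs1 j)
  · intro c hc
    have h1 : ∀ᶠ s in 𝓝[>] (1:ℝ), A / Real.Gamma (α + 1) * s ^ α < c :=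
      (hpow.mono_left nhdsWithin_le_nhds).eventually_lt_const hc
    obtain ⟨s, hsc, hs1⟩ := (h1.and self_mem_nhdsWithin).exists
    have hs1 : 1 < s := hs1
    have h2 := hcont _ (ramp_cont 1 s)
    have h3 := mul_le_mul_of_nonneg_left (int_ramp α hα 1 s one_pos hs1).2
      (show 0 ≤ A / Real.Gamma α by positivity)
    rw [hval] at h3
    filter_upwards [h2.eventually_lt_const (lt_of_le_of_lt h3 hsc)] with j hj
    exact lt_of_le_of_lt (hup 1 s hs1 le_rfl j) hj

lemma hasSum_succ_geom (x : ℝ) (hx0 : 0 < x) (hx1 : x < 1) :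
    HasSum (fun N : ℕ => ((N:ℝ) + 1) * x ^ N) (1 / (1 - x) ^ 2) := by
  have hn : ‖x‖ < 1 := by rw [Real.norm_of_nonneg hx0.le]; exact hx1
  have h1 := hasSum_coe_mul_geometric_of_norm_lt_one hn
  have h2 := hasSum_geometric_of_lt_one hx0.le hx1
  have h3 := h1.add h2
  have : (1 - x) ≠ 0 := by linarith
  have e1 : (fun N : ℕ => ((N:ℝ) + 1) * x ^ N) = fun N : ℕ => (N:ℝ) * x ^ N + x ^ N := by
    funext N; ring
  have e2 : 1 / (1 - x) ^ 2 = x / (1 - x) ^ 2 + (1 - x)⁻¹ := by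
    field_simp; ring
  rw [e1, e2]
  exact h3

lemma laplace_bound (w u : ℕ → ℝ) (M q0 : ℝ) (hw0 : ∀ n, 0 ≤ w n) (hwb : ∀ n : ℕ, w n ≤ n * q0)
    (hu0 : ∀ i, 0 ≤ u i) (huM : ∀ i, u i ≤ M) (ε D : ℝ)
    (h : ∀ N : ℕ, |∑ i ∈ Finset.range (N + 1), w (N - i + 1) * u i - (N + 1)| ≤ ε * (N + 1) + D)
    (x : ℝ) (hx0 : 0 < x) (hx1 : x < 1) :
    |(1 - x) ^ 2 * ((∑' n, w (n + 1) * x ^ n) * ∑' i, u i * x ^ i) - 1| ≤ ε + D * (1 - x) := by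
  have h1x : 0 < 1 - x := by linarith
  have hg1 := hasSum_succ_geom x hx0 hx1
  have hg2 := hasSum_geometric_of_lt_one hx0.le hx1
  have hsw : Summable (fun n => w (n + 1) * x ^ n) := by
    refine Summable.of_nonneg_of_le (fun n => mul_nonneg (hw0 _) (by positivity)) (fun n => ?_)
      (hg1.summable.mul_left q0)
    have := hwb (n + 1)
    push_cast at this
    have h2 : 0 < x ^ n := by positivity
    nlinarith
  have hsu : Summable (fun n => u n * x ^ n) := by
    refine Summable.of_nonneg_of_le (fun n => mul_nonneg (hu0 _) (by positivity)) (fun n => ?_)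
      (hg2.summable.mul_left M)
    exact mul_le_mul_of_nonneg_right (huM n) (by positivity)
  have hprod := tsum_mul_tsum_eq_tsum_sum_range_of_summable_norm hsu.norm hsw.norm
  have hsp := summable_norm_sum_mul_range_of_summable_norm hsu.norm hsw.norm
  have hS : ∀ N, ∑ k ∈ Finset.range (N + 1), u k * x ^ k * (w (N - k + 1) * x ^ (N - k)) =
      (∑ i ∈ Finset.range (N + 1), w (N - i + 1) * u i) * x ^ N := by
    intro N
    rw [Finset.sum_mul]
    apply Finset.sum_congr rfl
    intro k hk
    have : x ^ N = x ^ k * x ^ (N - k) := by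
      rw [← pow_add]; congr 1; simp at hk; omega
    rw [this]; ring
  simp only [hS] at hprod hsp
  have hsp' := hsp.of_norm
  have hle : |∑' N : ℕ, ((∑ i ∈ Finset.range (N + 1), w (N - i + 1) * u i) * x ^ N) - 1 / (1 - x) ^ 2|
      ≤ ε * (1 / (1 - x) ^ 2) + D * (1 - x)⁻¹ := by
    have hdiff := hsp'.hasSum.sub hg1
    have hb := (hg1.mul_left ε).add (hg2.mul_left D)
    rw [← Real.norm_eq_abs]
    refine hdiff.norm_le_of_bounded hb fun N => ?_
    rw [← sub_mul, norm_mul, Real.norm_of_nonneg (by positivity : 0 ≤ x ^ N)]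
    have := mul_le_mul_of_nonneg_right (h N) (by positivity : 0 ≤ x ^ N)
    rw [Real.norm_eq_abs]
    calc _ ≤ _ := this
      _ = _ := by ring
  rw [← hprod] at hle
  have e : (1 - x) ^ 2 * ((∑' n, w (n + 1) * x ^ n) * ∑' i, u i * x ^ i) - 1 =
      (1 - x) ^ 2 * ((∑' i, u i * x ^ i) * (∑' n, w (n + 1) * x ^ n) - 1 / (1 - x) ^ 2) := by
    field_simp
  rw [e, abs_mul, abs_of_nonneg (by positivity)]
  calc _ ≤ (1 - x) ^ 2 * (ε * (1 / (1 - x) ^ 2) + D * (1 - x)⁻¹) := by gcongr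
    _ = _ := by field_simp

/-- Uniform Tauberian theorem. -/
lemma tauber (α : ℝ) (hα : α ∈ Set.Ioo (0:ℝ) 1)
    (q : ℕ → ℝ) (hq : Antitone q) (hq0 : ∀ n, 0 ≤ q n)
    (w : ℕ → ℝ) (hwq : ∀ n, w n = ∑ k ∈ Finset.range n, q k)
    (hwpos : ∀ n, 0 < n → 0 < w n)
    (hr : ∀ (a b : ℕ → ℕ) (t : ℝ), 0 < t → Tendsto b atTop atTop →
      Tendsto (fun n => (a n : ℝ) / b n) atTop (𝓝 t) →
      Tendsto (fun n => w (a n) / w (b n)) atTop (𝓝 (t ^ (1 - α))))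
    (u : ℕ → ℕ → ℝ) (m : ℕ → ℕ) (hm : ∀ j, 0 < m j) (hmt : Tendsto m atTop atTop) (M : ℝ)
    (hu0 : ∀ j i, 0 ≤ u j i) (huM : ∀ j i, u j i ≤ M)
    (h : ∀ ε : ℝ, 0 < ε → ∃ D : ℝ, ∀ j N : ℕ,
      |∑ i ∈ Finset.range (N + 1), w (N - i + 1) * u j i - (N + 1)| ≤ ε * (N + 1) + D) :
    Tendsto (fun j => (∑ i ∈ Finset.range (m j + 1), u j i) * (w (m j) / m j)) atTop
      (𝓝 (1 / (Real.Gamma (2 - α) * Real.Gamma (α + 1)))) := by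
  have hw0 : ∀ n, 0 ≤ w n := fun n => by rw [hwq]; exact Finset.sum_nonneg fun i _ => hq0 i
  have hwb : ∀ n : ℕ, w n ≤ n * q 0 := by
    intro n
    have := sum_upper q hq 0 n
    simpa [← hwq] using this
  have hG2 := Real.Gamma_pos_of_pos (show 0 < 2 - α by linarith [hα.2])
  have hmR : ∀ j, (0:ℝ) < m j := fun j => by exact_mod_cast hm j
  have hmtR : Tendsto (fun j => (m j : ℝ)) atTop atTop := tendsto_natCast_atTop_atTop.comp hmt
  -- Laplace transforms
  have hL : ∀ lam : ℝ, 0 < lam → Tendsto (fun j => (∑' i, u j i * (Real.exp (-(lam / m j))) ^ i) *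
      (w (m j) / m j)) atTop (𝓝 (1 / Real.Gamma (2 - α) * lam ^ (-α))) := by
    intro lam hl
    have hx1 : ∀ j, Real.exp (-(lam / m j)) < 1 := fun j => by
      rw [Real.exp_lt_one_iff, neg_lt_zero]
      exact div_pos hl (hmR j)
    have hy : Tendsto (fun j => -(lam / m j)) atTop (𝓝 0) := by
      have := (hmtR.const_div_atTop lam).neg
      simpa using this
    have hx : Tendsto (fun j => Real.exp (-(lam / m j))) atTop (𝓝 1) := by
      have := (Real.continuous_exp.tendsto 0).comp hy
      rw [Real.exp_zero] at this
      exact this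
    have c1 : Tendsto (fun j => (1 - Real.exp (-(lam / m j))) ^ 2 *
        ((∑' n, w (n + 1) * (Real.exp (-(lam / m j))) ^ n) *
        ∑' i, u j i * (Real.exp (-(lam / m j))) ^ i)) atTop (𝓝 1) := by
      rw [Metric.tendsto_nhds]
      intro ε hε
      obtain ⟨D, hD⟩ := h (ε / 2) (by positivity)
      have h0 : Tendsto (fun j => D * (1 - Real.exp (-(lam / m j)))) atTop (𝓝 0) := by
        have := (hx.const_sub 1).const_mul D
        simpa using this
      filter_upwards [h0.eventually_lt_const (show 0 < ε / 2 by positivity)] with j hj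
      rw [Real.dist_eq]
      have := laplace_bound w (u j) M (q 0) hw0 hwb (hu0 j) (huM j) (ε/2) D (hD j) _
        (Real.exp_pos (-(lam / m j))) (hx1 j)
      linarith
    have c2 : Tendsto (fun j => (m j : ℝ) * (1 - Real.exp (-(lam / m j)))) atTop (𝓝 lam) := by
      have hd := (Real.hasDerivAt_exp 0)
      rw [Real.exp_zero, hasDerivAt_iff_tendsto_slope] at hd
      have hy' : Tendsto (fun j => -(lam / m j)) atTop (𝓝[≠] 0) := by
        rw [tendsto_nhdsWithin_iff]
        refine ⟨hy, Eventually.of_forall fun j => ?_⟩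
        exact (neg_lt_zero.2 (div_pos hl (hmR j))).ne
      have := (hd.comp hy').const_mul lam
      rw [mul_one] at this
      refine this.congr fun j => ?_
      simp only [Function.comp, slope_def_field, Real.exp_zero]
      have := hmR j
      generalize Real.exp (-(lam / m j)) = y
      rw [sub_zero, div_neg]
      field_simp
      ring
    have c3 := (abelian α hα q hq hq0 w hwq hwpos hr lam hl).comp hmt
    have hlp : 0 < lam ^ (-(2 - α)) := Real.rpow_pos_of_pos hl _
    have c4 := (c1.div c3 (by positivity)).div (c2.pow 2) (by positivity)
    have e : 1 / (Real.Gamma (2 - α) * lam ^ (-(2 - α))) / lam ^ 2 =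
        1 / Real.Gamma (2 - α) * lam ^ (-α) := by
      rw [Real.rpow_neg hl.le, Real.rpow_neg hl.le, Real.rpow_sub hl]
      have := Real.rpow_pos_of_pos hl α
      rw [Real.rpow_two]
      field_simp
    rw [e] at c4
    refine c4.congr' ?_
    have hWne : ∀ᶠ j in atTop, (∑' n, w (n + 1) * (Real.exp (-(lam / m j))) ^ n) / (m j * w (m j)) ≠ 0 :=
      c3.eventually_ne (by positivity)
    filter_upwards [hWne] with j hj
    have h1 := hmR j
    have h2 := hwpos _ (hm j)
    have h3 : 0 < 1 - Real.exp (-(lam / m j)) := by linarith [hx1 j]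
    simp only [Function.comp, Pi.div_apply]
    have h4 : (∑' n, w (n + 1) * (Real.exp (-(lam / m j))) ^ n) ≠ 0 := by
      intro h0; apply hj; rw [h0, zero_div]
    generalize (∑' n, w (n + 1) * (Real.exp (-(lam / m j))) ^ n) = W at h4 ⊢
    generalize (∑' i, u j i * (Real.exp (-(lam / m j))) ^ i) = U
    generalize 1 - Real.exp (-(lam / m j)) = y at h3 ⊢
    field_simp
  have hk := karamata α (1 / Real.Gamma (2 - α)) hα.1 (by positivity)
    (fun j i => u j i * (w (m j) / m j)) m hm
    (fun j i => mul_nonneg (hu0 j i) (div_nonneg (hw0 _) (hmR j).le)) (fun j => by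
      have hx1 : Real.exp (-(1 / m j)) < 1 := by
        rw [Real.exp_lt_one_iff, neg_lt_zero]
        exact div_pos one_pos (hmR j)
      have hg2 := (hasSum_geometric_of_lt_one (Real.exp_pos (-(1 / (m j : ℝ)))).le hx1).summable
      refine Summable.of_nonneg_of_le (fun i => mul_nonneg (mul_nonneg (hu0 j i)
        (div_nonneg (hw0 _) (hmR j).le)) (Real.exp_pos _).le) (fun i => ?_)
        (hg2.mul_left (M * (w (m j) / m j)))
      have e : Real.exp (-((i:ℝ) / m j)) = Real.exp (-(1 / m j)) ^ i := by
        rw [← Real.exp_nat_mul]; congr 1; ring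
      rw [e]
      have := mul_le_mul_of_nonneg_right (huM j i) (div_nonneg (hw0 (m j)) (hmR j).le)
      exact mul_le_mul_of_nonneg_right this (by positivity)) (fun k => by
      refine (hL ((k:ℝ) + 1) (by positivity)).congr fun j => ?_
      rw [← tsum_mul_right]
      congr 1
      ext i
      have e : Real.exp (-(((k:ℝ) + 1) / m j)) ^ i =
          Real.exp (-((i:ℝ) / m j)) * Real.exp (-((i:ℝ) / m j)) ^ k := by
        rw [← Real.exp_nat_mul, ← Real.exp_nat_mul, ← Real.exp_add]; congr 1; ring
      rw [e]; ring)
  rw [div_div] at hk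
  refine hk.congr fun j => ?_
  rw [Finset.sum_mul]

lemma scalar_bound
    (q : ℕ → ℝ) (hq : Antitone q) (hq0 : ∀ n, 0 ≤ q n)
    (w : ℕ → ℝ) (hwq : ∀ n, w n = ∑ k ∈ Finset.range n, q k)
    (p r : ℕ → ℕ → ℝ) (b : ℕ → ℕ → ℕ → ℝ) (M C : ℝ) (K : ℕ) (hM : 0 ≤ M) (hC : 0 ≤ C)
    (hp0 : ∀ j i, 0 ≤ p j i) (hpM : ∀ j i, p j i ≤ M) (hr0 : ∀ j i, 0 ≤ r j i)
    (hrC : ∀ j i, r j i ≤ C * ∑ l ∈ Finset.range (K + 1), p j (i + l))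
    (hb0 : ∀ j n i, 0 ≤ b j n i) (hbn : ∀ j n i, b j n i ≤ n)
    (hid : ∀ j N : ℕ, ∑ i ∈ Finset.range (N + 1), b j (N - i + 1) i = N + 1)
    (happ : ∀ ε : ℝ, 0 < ε → ∃ n0 : ℕ, ∀ n, n0 ≤ n → ∀ j i,
      |b j n i - w n * p j i| ≤ ε * w n * r j i)
    (ε : ℝ) (hε : 0 < ε) : ∃ D : ℝ, ∀ j N : ℕ,
      |∑ i ∈ Finset.range (N + 1), w (N - i + 1) * p j i - (N + 1)| ≤ ε * (N + 1) + D := by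
  have hw0 : ∀ n, 0 ≤ w n := fun n => by rw [hwq]; exact Finset.sum_nonneg fun i _ => hq0 i
  have hwmono : Monotone w := by
    refine monotone_nat_of_le_succ fun n => ?_
    rw [hwq, hwq, Finset.sum_range_succ]
    linarith [hq0 n]
  have hwadd : ∀ n l : ℕ, l ≤ K → w (n + 1 + l) ≤ (1 + K) * w (n + 1) := by
    intro n l hl
    have h1 := sum_upper q hq (n + 1) l
    rw [← hwq, ← hwq] at h1
    have h2 : q (n + 1) ≤ q 0 := hq (Nat.zero_le _)
    have h3 : w 1 ≤ w (n + 1) := hwmono (by omega)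
    have h4 : w 1 = q 0 := by rw [hwq]; simp
    have h5 : (l:ℝ) ≤ K := by exact_mod_cast hl
    have h6 : (l:ℝ) * q (n + 1) ≤ K * w (n + 1) :=
      mul_le_mul h5 (by linarith) (hq0 _) (by positivity)
    linarith
  set η : ℝ := min (1/2) (ε/2) / ((C + 1) * (K + 1) ^ 2) with hη
  have hηpos : 0 < η := by positivity
  obtain ⟨n0, hn0⟩ := happ η hηpos
  set E : ℝ := n0 + w n0 * M with hE
  have hE0 : 0 ≤ E := by have := hw0 n0; positivity
  set D2 : ℝ := η * C * (K + 1) * (K * (w K * M)) + n0 * E with hD2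
  refine ⟨2 * D2, fun j N => ?_⟩
  set S := ∑ i ∈ Finset.range (N + 1), w (N - i + 1) * p j i with hS
  set Δ := |S - (N + 1)| with hΔ
  -- shifted sums
  have hshift : ∀ l ∈ Finset.range (K + 1),
      ∑ i ∈ Finset.range (N + 1), w (N - i + 1) * p j (i + l) ≤ (1 + K) * S + K * (w K * M) := by
    intro l hl
    have hlK : l ≤ K := by simp at hl; omega
    have e1 : ∑ i ∈ Finset.range (N + 1), w (N - i + 1) * p j (i + l) ≤
        ∑ i ∈ Finset.range (l + (N + 1)), w (N + l - i + 1) * p j i := by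
      rw [Finset.sum_range_add _ l (N + 1)]
      have : ∑ x ∈ Finset.range (N + 1), w (N + l - (l + x) + 1) * p j (l + x) =
          ∑ i ∈ Finset.range (N + 1), w (N - i + 1) * p j (i + l) := by
        apply Finset.sum_congr rfl
        intro x hx
        rw [show N + l - (l + x) = N - x by omega, add_comm l x]
      rw [this]
      have : 0 ≤ ∑ x ∈ Finset.range l, w (N + l - x + 1) * p j x :=
        Finset.sum_nonneg fun i _ => mul_nonneg (hw0 _) (hp0 _ _)
      linarith
    refine e1.trans ?_
    rw [add_comm l (N + 1), Finset.sum_range_add]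
    apply add_le_add
    · rw [hS, Finset.mul_sum]
      apply Finset.sum_le_sum
      intro i hi
      rw [← mul_assoc]
      apply mul_le_mul_of_nonneg_right _ (hp0 _ _)
      have := hwadd (N - i) l hlK
      rwa [show N - i + 1 + l = N + l - i + 1 by simp at hi; omega] at this
    · calc _ ≤ ∑ x ∈ Finset.range l, w K * M := by
            apply Finset.sum_le_sum
            intro i hi
            apply mul_le_mul (hwmono (by simp at hi; omega)) (hpM _ _) (hp0 _ _) (hw0 _)
        _ = l * (w K * M) := by simp
        _ ≤ K * (w K * M) := by
            have : (l:ℝ) ≤ K := by exact_mod_cast hlK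
            exact mul_le_mul_of_nonneg_right this (mul_nonneg (hw0 _) hM)
  have hrsum : ∑ i ∈ Finset.range (N + 1), w (N - i + 1) * r j i ≤
      C * ((K + 1) * ((1 + K) * S + K * (w K * M))) := by
    calc _ ≤ ∑ i ∈ Finset.range (N + 1), w (N - i + 1) *
          (C * ∑ l ∈ Finset.range (K + 1), p j (i + l)) :=
          Finset.sum_le_sum fun i _ => mul_le_mul_of_nonneg_left (hrC j i) (hw0 _)
      _ = C * ∑ l ∈ Finset.range (K + 1), ∑ i ∈ Finset.range (N + 1),
          w (N - i + 1) * p j (i + l) := by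
          rw [Finset.sum_comm, Finset.mul_sum]
          apply Finset.sum_congr rfl
          intro i _
          rw [Finset.mul_sum, Finset.mul_sum, Finset.mul_sum]
          apply Finset.sum_congr rfl
          intro l _
          ring
      _ ≤ C * ∑ l ∈ Finset.range (K + 1), ((1 + K) * S + K * (w K * M)) :=
          mul_le_mul_of_nonneg_left (Finset.sum_le_sum hshift) hC
      _ = _ := by
          rw [Finset.sum_const, Finset.card_range, nsmul_eq_mul]
          push_cast
          ring
  have hterm : ∀ i ∈ Finset.range (N + 1), |w (N - i + 1) * p j i - b j (N - i + 1) i| ≤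
      η * (w (N - i + 1) * r j i) + if N - i < n0 then E else 0 := by
    intro i _
    by_cases h : N - i < n0
    · rw [if_pos h]
      have h1 : 0 ≤ η * (w (N - i + 1) * r j i) :=
        mul_nonneg hηpos.le (mul_nonneg (hw0 _) (hr0 _ _))
      have h2 : w (N - i + 1) * p j i ≤ w n0 * M :=
        mul_le_mul (hwmono (by omega)) (hpM _ _) (hp0 _ _) (hw0 _)
      have h3 : b j (N - i + 1) i ≤ n0 := (hbn _ _ _).trans (by exact_mod_cast h)
      have h4 := hb0 j (N - i + 1) i
      have h5 := mul_nonneg (hw0 (N - i + 1)) (hp0 j i)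
      have h6 := mul_nonneg (hw0 n0) hM
      have h7 : (0:ℝ) ≤ n0 := by positivity
      rw [abs_le]
      constructor <;> linarith
    · rw [if_neg h, add_zero, abs_sub_comm, ← mul_assoc]
      exact hn0 _ (by omega) j i
  have hEsum : ∑ i ∈ Finset.range (N + 1), (if N - i < n0 then E else 0) ≤ n0 * E := by
    rw [← Finset.sum_range_reflect]
    calc _ = ∑ i ∈ Finset.range (N + 1), (if i < n0 then E else 0) := by
          apply Finset.sum_congr rfl
          intro i hi
          rw [show N - (N + 1 - 1 - i) = i by simp at hi; omega]
      _ = ∑ i ∈ (Finset.range (N + 1)).filter (· < n0), E := by rw [Finset.sum_filter]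
      _ ≤ ∑ i ∈ Finset.range n0, E := by
          apply Finset.sum_le_sum_of_subset_of_nonneg
          · intro i hi
            simp at hi ⊢
            exact hi.2
          · intros; exact hE0
      _ = n0 * E := by simp
  have hΔ1 : Δ ≤ η * (C * ((K + 1) * ((1 + K) * S + K * (w K * M)))) + n0 * E := by
    have : S - (N + 1) = ∑ i ∈ Finset.range (N + 1), (w (N - i + 1) * p j i - b j (N - i + 1) i) := by
      rw [Finset.sum_sub_distrib, hid]
    rw [hΔ, this]
    refine (Finset.abs_sum_le_sum_abs _ _).trans ((Finset.sum_le_sum hterm).trans ?_)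
    rw [Finset.sum_add_distrib, ← Finset.mul_sum]
    exact add_le_add (mul_le_mul_of_nonneg_left hrsum hηpos.le) hEsum
  set θ : ℝ := η * C * (K + 1) ^ 2 with hθ
  have hθ1 : θ ≤ min (1/2) (ε/2) := by
    have : θ = min (1/2) (ε/2) * (C / (C + 1)) := by
      rw [hθ, hη]; field_simp
    rw [this]
    apply mul_le_of_le_one_right (by positivity)
    rw [div_le_one (by positivity)]; linarith
  have hθ0 : 0 ≤ θ := by positivity
  have hΔ2 : Δ ≤ θ * S + D2 := by
    rw [hθ, hD2]
    calc _ ≤ _ := hΔ1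
      _ = _ := by ring
  have hSΔ : S ≤ (N + 1) + Δ := by
    have := le_abs_self (S - (N + 1)); linarith
  have hΔ0 : 0 ≤ Δ := abs_nonneg _
  have h1 : θ ≤ 1/2 := hθ1.trans (min_le_left _ _)
  have h2 : θ ≤ ε/2 := hθ1.trans (min_le_right _ _)
  have hN : (0:ℝ) ≤ N + 1 := by positivity
  nlinarith [mul_le_mul_of_nonneg_left hSΔ hθ0, mul_le_mul_of_nonneg_right h1 hΔ0,
    mul_le_mul_of_nonneg_right h2 hN]

section dyn

lemma lt_firstReturn {X : Type*} (T : X → X) (Y : Set X) (x : X) (k : ℕ) :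
    (k : ℕ∞) < firstReturn T Y x ↔ ∀ i, 1 ≤ i → i ≤ k → T^[i] x ∉ Y := by
  unfold firstReturn
  constructor
  · intro h i h1 h2 hY
    have : (⨅ (k : ℕ) (_ : 1 ≤ k ∧ T^[k] x ∈ Y), (k : ℕ∞)) ≤ (i : ℕ∞) := iInf₂_le i ⟨h1, hY⟩
    have h3 := lt_of_lt_of_le h this
    have : k < i := by exact_mod_cast h3
    omega
  · intro h
    have : ((k + 1 : ℕ) : ℕ∞) ≤ ⨅ (k : ℕ) (_ : 1 ≤ k ∧ T^[k] x ∈ Y), (k : ℕ∞) := by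
      refine le_iInf₂ fun i hi => ?_
      have : k + 1 ≤ i := by
        by_contra hh
        exact h i hi.1 (by omega) hi.2
      exact_mod_cast this
    refine lt_of_lt_of_le ?_ this
    exact_mod_cast Nat.lt_succ_self k

lemma firstReturn_eq {X : Type*} (T : X → X) (Y : Set X) (x : X) (n : ℕ) :
    firstReturn T Y x = ((n + 1 : ℕ) : ℕ∞) ↔
      (n : ℕ∞) < firstReturn T Y x ∧ ¬ ((n + 1 : ℕ) : ℕ∞) < firstReturn T Y x := by
  constructor
  · intro h
    rw [h]
    refine ⟨by exact_mod_cast Nat.lt_succ_self n, lt_irrefl _⟩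
  · rintro ⟨h1, h2⟩
    apply le_antisymm (not_lt.1 h2)
    have := Order.add_one_le_of_lt h1
    exact_mod_cast this

lemma mem_Ypart {X : Type*} (T : X → X) (Y : Set X) (x : X) (n : ℕ) :
    x ∈ Ypart T Y n ↔ T^[n] x ∈ Y ∧ ∀ i < n, T^[i] x ∉ Y := by
  cases n with
  | zero => simp [Ypart]
  | succ n =>
    simp only [Ypart, Set.mem_inter_iff, Set.mem_compl_iff, Set.mem_ofPred_eq]
    rw [firstReturn_eq, lt_firstReturn, lt_firstReturn]
    constructor
    · rintro ⟨h0, h1, h2⟩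
      push Not at h2
      obtain ⟨i, hi1, hi2, hi3⟩ := h2
      have : i = n + 1 := by
        by_contra hh
        exact h1 i hi1 (by omega) hi3
      subst this
      refine ⟨hi3, fun j hj => ?_⟩
      rcases Nat.eq_zero_or_pos j with rfl | hj0
      · exact h0
      · exact h1 j hj0 (by omega)
    · rintro ⟨h1, h2⟩
      refine ⟨h2 0 (by omega), fun i _ hi => h2 i (by omega), fun h => ?_⟩
      exact h (n + 1) (by omega) le_rfl h1

lemma Ypart_disj {X : Type*} (T : X → X) (Y : Set X) :
    Pairwise (Function.onFun Disjoint (Ypart T Y)) := by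
  intro i j hij
  rw [Function.onFun, Set.disjoint_left]
  intro x hi hj
  rw [mem_Ypart] at hi hj
  rcases lt_or_gt_of_ne hij with h | h
  · exact hj.2 i h hi.1
  · exact hi.2 j h hj.1

/-- The tail sets `Y ∩ {φ > n}`. -/
def Atail {X : Type*} (T : X → X) (Y : Set X) (n : ℕ) : Set X :=
  Y ∩ {x | (n : ℕ∞) < firstReturn T Y x}

lemma Atail_anti {X : Type*} (T : X → X) (Y : Set X) : Antitone (Atail T Y) := by
  intro a b hab x hx
  refine ⟨hx.1, ?_⟩
  have h2 : ((b : ℕ) : ℕ∞) < firstReturn T Y x := hx.2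
  exact lt_of_le_of_lt (a := (a : ℕ∞)) (by exact_mod_cast hab) h2

lemma Atail_sub {X : Type*} (T : X → X) (Y : Set X) (n : ℕ) : Atail T Y n ⊆ Y := fun _ h => h.1

variable {X : Type*} [MeasurableSpace X] {μ : Measure X} {T : X → X} {Y : Set X}

lemma measurable_Atail (hT : Measurable T) (hYm : MeasurableSet Y) (n : ℕ) :
    MeasurableSet (Atail T Y n) := by
  have : Atail T Y n = Y ∩ ⋂ (i : ℕ) (_ : 1 ≤ i) (_ : i ≤ n), (T^[i] ⁻¹' Y)ᶜ := by
    ext x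
    simp [Atail, lt_firstReturn]
  rw [this]
  refine hYm.inter (MeasurableSet.iInter fun i => MeasurableSet.iInter fun _ =>
    MeasurableSet.iInter fun _ => (hT.iterate i hYm).compl)

lemma measurable_Ypart (hT : Measurable T) (hYm : MeasurableSet Y) (n : ℕ) :
    MeasurableSet (Ypart T Y n) := by
  have : Ypart T Y n = T^[n] ⁻¹' Y ∩ ⋂ (i : ℕ) (_ : i < n), (T^[i] ⁻¹' Y)ᶜ := by
    ext x
    simp [mem_Ypart]
  rw [this]
  exact (hT.iterate n hYm).inter (MeasurableSet.iInter fun i => MeasurableSet.iInter fun _ =>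
    (hT.iterate i hYm).compl)

/-- The renewal identity. -/
lemma renewal_id (hT : MeasurePreserving T μ μ) (hYm : MeasurableSet Y) (A : Set X)
    (hA : MeasurableSet A) (hAY : A ⊆ Y) (n : ℕ) :
    ∑ k ∈ Finset.range (n + 1), μ (Ypart T Y k ∩ T^[n] ⁻¹' A) = μ A := by
  rw [← (hT.iterate n).measure_preimage hA.nullMeasurableSet, ← measure_biUnion_finset]
  · congr 1
    ext x
    simp only [Set.mem_iUnion, Finset.mem_range, Set.mem_inter_iff, exists_prop]
    constructor
    · rintro ⟨k, _, _, h⟩; exact h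
    · intro h
      have hex : ∃ k, T^[k] x ∈ Y := ⟨n, hAY h⟩
      classical
      refine ⟨Nat.find hex, ?_, ?_, h⟩
      · have := Nat.find_min' hex (hAY h)
        omega
      · rw [mem_Ypart]
        exact ⟨Nat.find_spec hex, fun i hi => Nat.find_min hex hi⟩
  · intro i _ j _ hij
    exact (Ypart_disj T Y hij).mono Set.inter_subset_left Set.inter_subset_left
  · intro i _
    exact (measurable_Ypart hT.measurable hYm i).inter (hT.measurable.iterate n hA)

variable {hatT : (X → ℝ≥0∞) → (X → ℝ≥0∞)}

lemma iter_meas (hatTmeas : ∀ u, Measurable u → Measurable (hatT u)) (u : X → ℝ≥0∞)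
    (hu : Measurable u) (i : ℕ) : Measurable (hatT^[i] u) := by
  induction i with
  | zero => simpa using hu
  | succ i ih => rw [Function.iterate_succ_apply']; exact hatTmeas _ ih

lemma dual_iter (hT : Measurable T) (hatTmeas : ∀ u, Measurable u → Measurable (hatT u))
    (hatTdual : ∀ u v : X → ℝ≥0∞, Measurable u → Measurable v →
      ∫⁻ x, v (T x) * u x ∂μ = ∫⁻ x, v x * hatT u x ∂μ) (i : ℕ) :
    ∀ u v : X → ℝ≥0∞, Measurable u → Measurable v →
      ∫⁻ x, v (T^[i] x) * u x ∂μ = ∫⁻ x, v x * (hatT^[i] u) x ∂μ := by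
  induction i with
  | zero => intro u v _ _; simp
  | succ i ih =>
    intro u v hu hv
    rw [Function.iterate_succ_apply, ← ih (hatT u) v (hatTmeas u hu) hv]
    have := hatTdual u (fun x => v (T^[i] x)) hu (hv.comp (hT.iterate i))
    rw [← this]
    simp only [Function.iterate_succ_apply]

lemma dual_set (hT : Measurable T) (hatTmeas : ∀ u, Measurable u → Measurable (hatT u))
    (hatTdual : ∀ u v : X → ℝ≥0∞, Measurable u → Measurable v →
      ∫⁻ x, v (T x) * u x ∂μ = ∫⁻ x, v x * hatT u x ∂μ) (i : ℕ)
    (u : X → ℝ≥0∞) (hu : Measurable u) (A : Set X) (hA : MeasurableSet A) :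
    ∫⁻ x in A, (hatT^[i] u) x ∂μ = ∫⁻ x in T^[i] ⁻¹' A, u x ∂μ := by
  have h := dual_iter hT hatTmeas hatTdual i u (A.indicator fun _ => 1) hu
    (measurable_const.indicator hA)
  rw [← lintegral_indicator hA, ← lintegral_indicator (hT.iterate i hA)]
  convert h.symm using 2
  · ext x; by_cases hx : x ∈ A <;> simp [hx]
  · ext x; by_cases hx : T^[i] x ∈ A <;> simp [hx]

lemma entr_meas (hT : Measurable T) (hYm : MeasurableSet Y)
    (hatTmeas : ∀ u, Measurable u → Measurable (hatT u)) (n : ℕ) :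
    Measurable (entrance T Y μ hatT n) := by
  unfold entrance
  apply Measurable.div_const
  refine Finset.measurable_fun_sum _ fun k _ => ?_
  exact iter_meas hatTmeas _ (measurable_const.indicator (measurable_Ypart hT hYm k)) k

lemma entr_int (hT : Measurable T) (hYm : MeasurableSet Y)
    (hatTmeas : ∀ u, Measurable u → Measurable (hatT u))
    (hatTdual : ∀ u v : X → ℝ≥0∞, Measurable u → Measurable v →
      ∫⁻ x, v (T x) * u x ∂μ = ∫⁻ x, v x * hatT u x ∂μ) (n : ℕ) (B : Set X)
    (hB : MeasurableSet B) :
    ∫⁻ x in B, entrance T Y μ hatT n x ∂μ =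
      (∑ k ∈ Finset.range n, μ (Ypart T Y k ∩ T^[k] ⁻¹' B)) / wrate T Y μ n := by
  have hm : ∀ k, Measurable ((Ypart T Y k).indicator fun _ => (1:ℝ≥0∞)) := fun k =>
    measurable_const.indicator (measurable_Ypart hT hYm k)
  unfold entrance
  simp only [div_eq_mul_inv]
  rw [lintegral_mul_const _ (Finset.measurable_fun_sum _ fun k _ => iter_meas hatTmeas _ (hm k) k),
    lintegral_finsetSum _ fun k _ => iter_meas hatTmeas _ (hm k) k]
  congr 1
  apply Finset.sum_congr rfl
  intro k _
  rw [dual_set hT hatTmeas hatTdual k _ (hm k) B hB,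
    lintegral_indicator (measurable_Ypart hT hYm k), setLIntegral_const, one_mul,
    Measure.restrict_apply (measurable_Ypart hT hYm k)]

/-- `H` vanishes off `Y`. -/
lemma H_off (hT : Measurable T) (hYm : MeasurableSet Y)
    (hatTmeas : ∀ u, Measurable u → Measurable (hatT u))
    (hatTdual : ∀ u v : X → ℝ≥0∞, Measurable u → Measurable v →
      ∫⁻ x, v (T x) * u x ∂μ = ∫⁻ x, v x * hatT u x ∂μ)
    (H : X → ℝ≥0∞)
    (hA4 : ∀ ε : ℝ≥0∞, 0 < ε → ∀ᶠ n : ℕ in atTop, ∀ᵐ x ∂μ,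
      entrance T Y μ hatT n x ≤ H x + ε ∧ H x ≤ entrance T Y μ hatT n x + ε) :
    ∀ᵐ x ∂μ, x ∉ Y → H x = 0 := by
  have h1 : ∀ n, ∀ᵐ x ∂μ, x ∉ Y → entrance T Y μ hatT n x = 0 := by
    intro n
    have := entr_int (μ := μ) hT hYm hatTmeas hatTdual n Yᶜ hYm.compl
    have hz : ∑ k ∈ Finset.range n, μ (Ypart T Y k ∩ T^[k] ⁻¹' Yᶜ) = 0 := by
      apply Finset.sum_eq_zero
      intro k _
      have : Ypart T Y k ∩ T^[k] ⁻¹' Yᶜ = ∅ := by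
        ext x
        simp only [Set.mem_inter_iff, mem_Ypart, Set.mem_preimage, Set.mem_compl_iff,
          Set.mem_empty_iff_false, iff_false]
        tauto
      rw [this, measure_empty]
    rw [hz, ENNReal.zero_div, lintegral_eq_zero_iff (entr_meas hT hYm hatTmeas n)] at this
    have h2 := (ae_restrict_iff' hYm.compl).1 this
    filter_upwards [h2] with x hx hxY
    exact hx hxY
  have h2 : ∀ k : ℕ, ∀ᵐ x ∂μ, x ∉ Y → H x ≤ ((k:ℝ≥0∞) + 1)⁻¹ := by
    intro k
    obtain ⟨n, hn⟩ := (hA4 ((k:ℝ≥0∞) + 1)⁻¹ (by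
      rw [ENNReal.inv_pos]; exact ENNReal.add_ne_top.2 ⟨ENNReal.natCast_ne_top k, ENNReal.one_ne_top⟩)).exists
    filter_upwards [hn, h1 n] with x hx hx1 hxY
    have := hx.2
    rwa [hx1 hxY, zero_add] at this
  rw [← ae_all_iff] at h2
  filter_upwards [h2] with x hx hxY
  by_contra hne
  obtain ⟨k, hk⟩ := ENNReal.exists_inv_nat_lt hne
  have h3 := hx k hxY
  have h4 : ((k:ℝ≥0∞) + 1)⁻¹ ≤ (k:ℝ≥0∞)⁻¹ := ENNReal.inv_le_inv.2 le_self_add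
  exact absurd (lt_of_le_of_lt (h3.trans h4) hk) (lt_irrefl _)

/-- Integrated form of (A4). -/
lemma A4_int (hT : Measurable T) (hYm : MeasurableSet Y)
    (hatTmeas : ∀ u, Measurable u → Measurable (hatT u))
    (hatTdual : ∀ u v : X → ℝ≥0∞, Measurable u → Measurable v →
      ∫⁻ x, v (T x) * u x ∂μ = ∫⁻ x, v x * hatT u x ∂μ)
    (H : X → ℝ≥0∞) (hHmeas : Measurable H)
    (n : ℕ) (ε : ℝ≥0∞) (hn : ∀ᵐ x ∂μ,
      entrance T Y μ hatT n x ≤ H x + ε ∧ H x ≤ entrance T Y μ hatT n x + ε)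
    (B : Set X) :
      (∫⁻ x in B, entrance T Y μ hatT n x ∂μ ≤ ∫⁻ x in B, H x ∂μ + ε * μ B) ∧
      (∫⁻ x in B, H x ∂μ ≤ ∫⁻ x in B, entrance T Y μ hatT n x ∂μ + ε * μ B) := by
  have hn' := ae_restrict_of_ae (s := B) hn
  constructor
  · calc _ ≤ ∫⁻ x in B, (H x + ε) ∂μ := lintegral_mono_ae (hn'.mono fun x hx => hx.1)
      _ = _ := by rw [lintegral_add_left hHmeas, setLIntegral_const]
  · calc _ ≤ ∫⁻ x in B, (entrance T Y μ hatT n x + ε) ∂μ :=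
          lintegral_mono_ae (hn'.mono fun x hx => hx.2)
      _ = _ := by rw [lintegral_add_left (entr_meas hT hYm hatTmeas n), setLIntegral_const]

/-- Sweeping passes to the limit density. -/
lemma sweep (hT : MeasurePreserving T μ μ) (hYm : MeasurableSet Y) (hY1 : μ Y < ⊤)
    (hatTmeas : ∀ u, Measurable u → Measurable (hatT u))
    (hatTdual : ∀ u v : X → ℝ≥0∞, Measurable u → Measurable v →
      ∫⁻ x, v (T x) * u x ∂μ = ∫⁻ x, v x * hatT u x ∂μ)
    (hA3 : ∃ (N : ℕ) (C : ℝ≥0∞) (K : ℕ), C ≠ ⊤ ∧ ∀ n : ℕ, N ≤ n →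
      ∀ᵐ x ∂μ.restrict Y,
        1 ≤ C * ∑ j ∈ Finset.range (K + 1), (hatT^[j] (entrance T Y μ hatT n)) x)
    (H : X → ℝ≥0∞) (hHmeas : Measurable H)
    (hA4 : ∀ ε : ℝ≥0∞, 0 < ε → ∀ᶠ n : ℕ in atTop, ∀ᵐ x ∂μ,
      entrance T Y μ hatT n x ≤ H x + ε ∧ H x ≤ entrance T Y μ hatT n x + ε) :
    ∃ (C : ℝ≥0∞) (K : ℕ), C ≠ ⊤ ∧ ∀ A, MeasurableSet A → A ⊆ Y →
      μ A ≤ C * ∑ j ∈ Finset.range (K + 1), ∫⁻ x in T^[j] ⁻¹' A, H x ∂μ := by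
  obtain ⟨N, C, K, hC, h⟩ := hA3
  refine ⟨C, K, hC, fun A hA hAY => ?_⟩
  have hAfin : μ A ≠ ⊤ := ne_top_of_le_ne_top hY1.ne (measure_mono hAY)
  have key : ∀ ε : ℝ≥0∞, 0 < ε → μ A ≤ C * ∑ j ∈ Finset.range (K + 1), ∫⁻ x in T^[j] ⁻¹' A, H x ∂μ
      + ε * (C * ((K + 1) * μ A)) := by
    intro ε hε
    obtain ⟨n, hn, hnN⟩ := ((hA4 ε hε).and (eventually_ge_atTop N)).exists
    have h1 := h n hnN
    have h2 : ∀ᵐ x ∂μ.restrict A, 1 ≤ C * ∑ j ∈ Finset.range (K + 1),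
        (hatT^[j] (entrance T Y μ hatT n)) x :=
      ae_mono (Measure.restrict_mono hAY le_rfl) h1
    have hem := entr_meas (μ := μ) hT.measurable hYm hatTmeas n
    calc μ A = ∫⁻ x in A, 1 ∂μ := by simp
      _ ≤ ∫⁻ x in A, C * ∑ j ∈ Finset.range (K + 1),
        (hatT^[j] (entrance T Y μ hatT n)) x ∂μ := lintegral_mono_ae h2
      _ = C * ∑ j ∈ Finset.range (K + 1), ∫⁻ x in T^[j] ⁻¹' A, entrance T Y μ hatT n x ∂μ := by
        rw [lintegral_const_mul _ (Finset.measurable_fun_sum _ fun k _ => iter_meas hatTmeas _ hem k),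
          lintegral_finsetSum _ fun k _ => iter_meas hatTmeas _ hem k]
        congr 1
        apply Finset.sum_congr rfl
        intro j _
        rw [dual_set hT.measurable hatTmeas hatTdual j _ hem A hA]
      _ ≤ C * ∑ j ∈ Finset.range (K + 1), (∫⁻ x in T^[j] ⁻¹' A, H x ∂μ + ε * μ A) := by
        gcongr with j _
        have := (A4_int hT.measurable hYm hatTmeas hatTdual H hHmeas n ε hn (T^[j] ⁻¹' A)).1
        rwa [(hT.iterate j).measure_preimage hA.nullMeasurableSet] at this
      _ = _ := by
        rw [Finset.sum_add_distrib, mul_add]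
        congr 1
        simp only [Finset.sum_const, Finset.card_range, nsmul_eq_mul]
        push_cast
        ring
  have hfin : C * ((K + 1) * μ A) ≠ ⊤ := by
    refine ENNReal.mul_ne_top hC (ENNReal.mul_ne_top ?_ hAfin)
    exact ENNReal.add_ne_top.2 ⟨ENNReal.natCast_ne_top K, ENNReal.one_ne_top⟩
  have hlim : Tendsto (fun ε : ℝ≥0∞ => C * ∑ j ∈ Finset.range (K + 1), ∫⁻ x in T^[j] ⁻¹' A, H x ∂μ
      + ε * (C * ((K + 1) * μ A))) (𝓝[>] 0)
      (𝓝 (C * ∑ j ∈ Finset.range (K + 1), ∫⁻ x in T^[j] ⁻¹' A, H x ∂μ)) := by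
    have h1 : Tendsto (fun ε : ℝ≥0∞ => ε * (C * ((K + 1) * μ A))) (𝓝[>] 0) (𝓝 (0 * (C * ((K + 1) * μ A)))) :=
      (ENNReal.Tendsto.mul_const tendsto_id (Or.inr hfin)).mono_left nhdsWithin_le_nhds
    have h2 := (tendsto_const_nhds (x := C * ∑ j ∈ Finset.range (K + 1), ∫⁻ x in T^[j] ⁻¹' A, H x ∂μ)
      (f := 𝓝[>] (0:ℝ≥0∞))).add h1
    simpa using h2
  refine ge_of_tendsto hlim ?_
  filter_upwards [self_mem_nhdsWithin] with ε hε
  exact key ε hε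

end dyn

lemma tri_sum (g : ℕ → ℕ → ℝ≥0∞) (N : ℕ) :
    ∑ i ∈ Finset.range (N + 1), ∑ k ∈ Finset.range (N - i + 1), g k (i + k) =
      ∑ n ∈ Finset.range (N + 1), ∑ k ∈ Finset.range (n + 1), g k n := by
  induction N with
  | zero => simp
  | succ N ih =>
    rw [Finset.sum_range_succ, Finset.sum_range_succ _ (N + 1), ← ih]
    have h1 : ∀ i ∈ Finset.range (N + 1), ∑ k ∈ Finset.range (N + 1 - i + 1), g k (i + k) =
        ∑ k ∈ Finset.range (N - i + 1), g k (i + k) + g (N - i + 1) (N + 1) := by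
      intro i hi
      have hi' : i ≤ N := by simpa [Nat.lt_succ_iff] using hi
      rw [show N + 1 - i + 1 = (N - i + 1) + 1 by omega, Finset.sum_range_succ]
      congr 2
      omega
    rw [Finset.sum_congr rfl h1, Finset.sum_add_distrib, add_assoc]
    congr 1
    rw [Finset.sum_range_succ' _ (N + 1)]
    congr 1
    · rw [← Finset.sum_range_reflect (fun k => g (k + 1) (N + 1)) (N + 1)]
      apply Finset.sum_congr rfl
      intro i hi
      congr 1
    · simp

section dyn2

variable {X : Type*} [MeasurableSpace X] {μ : Measure X} {T : X → X} {Y : Set X}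

lemma wrate_eq (n : ℕ) (hY1 : μ Y < ⊤) :
    (wrate T Y μ n).toReal = ∑ k ∈ Finset.range n, (μ (Atail T Y k)).toReal := by
  unfold wrate
  rw [ENNReal.toReal_sum]
  · rfl
  · intro k _
    exact ((measure_mono Set.inter_subset_left).trans_lt hY1).ne

lemma Ypart_inter (k : ℕ) (B : Set X) :
    Ypart T Y k ∩ T^[k] ⁻¹' (Y ∩ B) = Ypart T Y k ∩ T^[k] ⁻¹' B := by
  ext x
  constructor
  · rintro ⟨h1, h2⟩; exact ⟨h1, h2.2⟩
  · rintro ⟨h1, h2⟩; exact ⟨h1, ((mem_Ypart T Y x k).1 h1).1, h2⟩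

lemma int_Y (H : X → ℝ≥0∞) (hYm : MeasurableSet Y) (hoff : ∀ᵐ x ∂μ, x ∉ Y → H x = 0) (B : Set X)
    (hB : MeasurableSet B) :
    ∫⁻ x in Y ∩ B, H x ∂μ = ∫⁻ x in B, H x ∂μ := by
  rw [← lintegral_indicator (hYm.inter hB), ← lintegral_indicator hB]
  apply lintegral_congr_ae
  filter_upwards [hoff] with x hx
  by_cases h1 : x ∈ Y
  · by_cases h2 : x ∈ B
    · rw [Set.indicator_of_mem h2, Set.indicator_of_mem (show x ∈ Y ∩ B from ⟨h1, h2⟩)]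
    · rw [Set.indicator_of_notMem h2,
        Set.indicator_of_notMem (show x ∉ Y ∩ B from fun h => h2 h.2)]
  · rw [Set.indicator_of_notMem (show x ∉ Y ∩ B from fun h => h1 h.1)]
    simp [Set.indicator, hx h1]

lemma renewal_bound (hT : MeasurePreserving T μ μ) (hYm : MeasurableSet Y) (hY1 : μ Y < ⊤)
    (hatT : (X → ℝ≥0∞) → (X → ℝ≥0∞))
    (hatTmeas : ∀ u, Measurable u → Measurable (hatT u))
    (hatTdual : ∀ u v : X → ℝ≥0∞, Measurable u → Measurable v →
      ∫⁻ x, v (T x) * u x ∂μ = ∫⁻ x, v x * hatT u x ∂μ)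
    (hA3 : ∃ (N : ℕ) (C : ℝ≥0∞) (K : ℕ), C ≠ ⊤ ∧ ∀ n : ℕ, N ≤ n →
      ∀ᵐ x ∂μ.restrict Y,
        1 ≤ C * ∑ j ∈ Finset.range (K + 1), (hatT^[j] (entrance T Y μ hatT n)) x)
    (H : X → ℝ≥0∞) (hHmeas : Measurable H)
    (hHbd : ∃ M : ℝ≥0∞, M ≠ ⊤ ∧ ∀ᵐ x ∂μ, H x ≤ M)
    (hA4 : ∀ ε : ℝ≥0∞, 0 < ε → ∀ᶠ n : ℕ in atTop, ∀ᵐ x ∂μ,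
      entrance T Y μ hatT n x ≤ H x + ε ∧ H x ≤ entrance T Y μ hatT n x + ε)
    (hpos : ∀ n, 0 < (μ (Atail T Y n)).toReal) :
    ∃ M : ℝ, (∀ j i, (∫⁻ x in T^[i] ⁻¹' Atail T Y j, H x ∂μ) ≠ ⊤) ∧
      (∀ j i, (∫⁻ x in T^[i] ⁻¹' Atail T Y j, H x ∂μ).toReal / (μ (Atail T Y j)).toReal ≤ M) ∧
      ∀ ε : ℝ, 0 < ε → ∃ D : ℝ, ∀ j N : ℕ,
      |∑ i ∈ Finset.range (N + 1), (wrate T Y μ (N - i + 1)).toReal *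
        ((∫⁻ x in T^[i] ⁻¹' Atail T Y j, H x ∂μ).toReal / (μ (Atail T Y j)).toReal) - (N + 1)|
        ≤ ε * (N + 1) + D := by
  obtain ⟨M, hM, hHM⟩ := hHbd
  have hoff := H_off hT.measurable hYm hatTmeas hatTdual H hA4
  obtain ⟨C, K, hC, hsw⟩ := sweep hT hYm hY1 hatTmeas hatTdual hA3 H hHmeas hA4
  have hAm : ∀ j, MeasurableSet (Atail T Y j) := fun j => measurable_Atail hT.measurable hYm j
  have hBm : ∀ i j, MeasurableSet (T^[i] ⁻¹' Atail T Y j) :=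
    fun i j => (hT.measurable.iterate i) (hAm j)
  have hμB : ∀ i j, μ (T^[i] ⁻¹' Atail T Y j) = μ (Atail T Y j) := fun i j =>
    (hT.iterate i).measure_preimage (hAm j).nullMeasurableSet
  have hAfin : ∀ j, μ (Atail T Y j) ≠ ⊤ := fun j =>
    ((measure_mono (Atail_sub T Y j)).trans_lt hY1).ne
  have hintle : ∀ j i, (∫⁻ x in T^[i] ⁻¹' Atail T Y j, H x ∂μ) ≤ M * μ (Atail T Y j) := by
    intro j i
    calc (∫⁻ x in T^[i] ⁻¹' Atail T Y j, H x ∂μ)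
        ≤ ∫⁻ x in T^[i] ⁻¹' Atail T Y j, M ∂μ := lintegral_mono_ae (ae_restrict_of_ae hHM)
      _ = M * μ (Atail T Y j) := by rw [setLIntegral_const, hμB]
  have hfin : ∀ j i, (∫⁻ x in T^[i] ⁻¹' Atail T Y j, H x ∂μ) ≠ ⊤ := fun j i =>
    ((hintle j i).trans_lt (ENNReal.mul_lt_top hM.lt_top (hAfin j).lt_top)).ne
  have hpM : ∀ j i, (∫⁻ x in T^[i] ⁻¹' Atail T Y j, H x ∂μ).toReal / (μ (Atail T Y j)).toReal
      ≤ M.toReal := by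
    intro j i
    rw [div_le_iff₀ (hpos j), ← ENNReal.toReal_mul]
    exact ENNReal.toReal_mono (ENNReal.mul_ne_top hM (hAfin j)) (hintle j i)
  refine ⟨M.toReal, hfin, hpM, ?_⟩
  set V : ℕ → ℕ → ℕ → ℝ≥0∞ := fun j n i =>
    ∑ k ∈ Finset.range n, μ (Ypart T Y k ∩ T^[k] ⁻¹' (T^[i] ⁻¹' Atail T Y j)) with hV
  have hcomp : ∀ i k j, T^[k] ⁻¹' (T^[i] ⁻¹' Atail T Y j) = T^[i + k] ⁻¹' Atail T Y j := by
    intro i k j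
    rw [Function.iterate_add, Set.preimage_comp]
  have hVle : ∀ j n i, V j n i ≤ n * μ (Atail T Y j) := by
    intro j n i
    calc V j n i ≤ ∑ k ∈ Finset.range n, μ (Atail T Y j) := by
          apply Finset.sum_le_sum
          intro k _
          rw [hcomp]
          exact (measure_mono Set.inter_subset_right).trans (hμB _ _).le
      _ = n * μ (Atail T Y j) := by simp
  have hVfin : ∀ j n i, V j n i ≠ ⊤ := fun j n i =>
    ((hVle j n i).trans_lt (ENNReal.mul_lt_top (by simp) (hAfin j).lt_top)).ne
  have hqanti : Antitone fun n => (μ (Atail T Y n)).toReal := fun a b hab =>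
    ENNReal.toReal_mono (hAfin a) (measure_mono (Atail_anti T Y hab))
  intro ε hε
  refine scalar_bound (fun n => (μ (Atail T Y n)).toReal) hqanti (fun n => (hpos n).le)
    (fun n => (wrate T Y μ n).toReal) (fun n => wrate_eq n hY1)
    (fun j i => (∫⁻ x in T^[i] ⁻¹' Atail T Y j, H x ∂μ).toReal / (μ (Atail T Y j)).toReal)
    (fun j i => (μ (Y ∩ T^[i] ⁻¹' Atail T Y j)).toReal / (μ (Atail T Y j)).toReal)
    (fun j n i => (V j n i).toReal / (μ (Atail T Y j)).toReal)
    M.toReal C.toReal K ENNReal.toReal_nonneg ENNReal.toReal_nonneg ?_ hpM ?_ ?_ ?_ ?_ ?_ ?_ ε hε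
  · intro j i; positivity
  · intro j i; positivity
  · intro j i
    have h1 := hsw (Y ∩ T^[i] ⁻¹' Atail T Y j) (hYm.inter (hBm i j)) Set.inter_subset_left
    have h2 : μ (Y ∩ T^[i] ⁻¹' Atail T Y j) ≤
        C * ∑ l ∈ Finset.range (K + 1), ∫⁻ x in T^[i + l] ⁻¹' Atail T Y j, H x ∂μ := by
      refine h1.trans ?_
      gcongr with l _
      rw [← hcomp]
      exact Set.preimage_mono Set.inter_subset_right
    have h3 := ENNReal.toReal_mono (ENNReal.mul_ne_top hC
      (ENNReal.sum_ne_top.2 fun l _ => hfin j (i + l))) h2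
    rw [ENNReal.toReal_mul, ENNReal.toReal_sum fun l _ => hfin j (i + l)] at h3
    rw [← Finset.sum_div, ← mul_div_assoc]
    exact div_le_div_of_nonneg_right h3 (hpos j).le
  · intro j n i; positivity
  · intro j n i
    rw [div_le_iff₀ (hpos j)]
    have := ENNReal.toReal_mono (ENNReal.mul_ne_top (by simp) (hAfin j)) (hVle j n i)
    simpa using this
  · intro j N
    rw [← Finset.sum_div, ← ENNReal.toReal_sum fun i _ => hVfin j _ i]
    have : ∑ i ∈ Finset.range (N + 1), V j (N - i + 1) i = (N + 1 : ℕ) * μ (Atail T Y j) := by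
      simp only [hV, hcomp]
      rw [tri_sum (fun k n => μ (Ypart T Y k ∩ T^[n] ⁻¹' Atail T Y j))]
      simp only [renewal_id hT hYm _ (hAm j) (Atail_sub T Y j)]
      simp
    rw [this, ENNReal.toReal_mul, mul_div_assoc, div_self (hpos j).ne',
      ENNReal.toReal_natCast]
    push_cast
    ring
  · intro δ hδ
    obtain ⟨n1, hn1⟩ := eventually_atTop.1 (hA4 (ENNReal.ofReal δ) (by simpa using hδ))
    refine ⟨max n1 1, fun n hn j i => ?_⟩
    have hn' := hn1 n (le_trans (le_max_left _ _) hn)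
    have hn0 : 0 < n := lt_of_lt_of_le one_pos (le_trans (le_max_right _ _) hn)
    obtain ⟨h1, h2⟩ := A4_int hT.measurable hYm hatTmeas hatTdual H hHmeas n _ hn'
      (Y ∩ T^[i] ⁻¹' Atail T Y j)
    rw [int_Y H hYm hoff _ (hBm i j), entr_int hT.measurable hYm hatTmeas hatTdual n _
      (hYm.inter (hBm i j))] at h1 h2
    simp only [Ypart_inter] at h1 h2
    change V j n i / wrate T Y μ n ≤ _ at h1
    change _ ≤ V j n i / wrate T Y μ n + _ at h2
    have hwpos : 0 < (wrate T Y μ n).toReal := by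
      rw [wrate_eq n hY1]
      exact Finset.sum_pos (fun k _ => hpos k) (by simpa using hn0.ne')
    have hw0 : wrate T Y μ n ≠ 0 := fun h => by simp [h] at hwpos
    have hrf : ENNReal.ofReal δ * μ (Y ∩ T^[i] ⁻¹' Atail T Y j) ≠ ⊤ :=
      ENNReal.mul_ne_top (by simp) ((measure_mono Set.inter_subset_left).trans_lt hY1).ne
    have hdf : V j n i / wrate T Y μ n ≠ ⊤ := ENNReal.div_ne_top (hVfin j n i) hw0
    have h1' := ENNReal.toReal_mono (ENNReal.add_ne_top.2 ⟨hfin j i, hrf⟩) h1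
    have h2' := ENNReal.toReal_mono (ENNReal.add_ne_top.2 ⟨hdf, hrf⟩) h2
    rw [ENNReal.toReal_add (hfin j i) hrf, ENNReal.toReal_div, ENNReal.toReal_mul,
      ENNReal.toReal_ofReal hδ.le] at h1'
    rw [ENNReal.toReal_add hdf hrf, ENNReal.toReal_div, ENNReal.toReal_mul,
      ENNReal.toReal_ofReal hδ.le] at h2'
    generalize (V j n i).toReal = v at *
    generalize (wrate T Y μ n).toReal = w at *
    generalize (∫⁻ x in T^[i] ⁻¹' Atail T Y j, H x ∂μ).toReal = p at *
    generalize (μ (Y ∩ T^[i] ⁻¹' Atail T Y j)).toReal = r at *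
    have hq := hpos j
    generalize (μ (Atail T Y j)).toReal = q at *
    have e1 : v ≤ w * (p + δ * r) := by rwa [div_le_iff₀ hwpos, mul_comm] at h1'
    have e2 : w * p ≤ v + w * (δ * r) := by
      have := mul_le_mul_of_nonneg_left h2' hwpos.le
      rwa [mul_add, mul_div_cancel₀ _ hwpos.ne'] at this
    rw [← mul_div_assoc, ← mul_div_assoc, ← sub_div, abs_div, abs_of_pos hq]
    apply div_le_div_of_nonneg_right _ hq.le
    rw [abs_le]
    constructor <;> linarith

end dyn2

lemma lastVisit_le {X : Type*} (T : X → X) (Y : Set X) (n m : ℕ) (x : X) :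
    lastVisit T Y n x ≤ m ↔ ∀ i, m < i → i ≤ n → T^[i] x ∉ Y := by
  unfold lastVisit
  have hb : BddAbove {k | k ≤ n ∧ T^[k] x ∈ Y} := ⟨n, fun k hk => hk.1⟩
  constructor
  · intro h i hi hin hY
    have : i ≤ sSup {k | k ≤ n ∧ T^[k] x ∈ Y} := le_csSup hb ⟨hin, hY⟩
    omega
  · intro h
    apply csSup_le'
    rintro k ⟨hk, hkY⟩
    by_contra hlt
    exact h k (not_le.1 hlt) hk hkY

section dyn3

variable {X : Type*} [MeasurableSpace X] {μ : Measure X} {T : X → X} {Y : Set X}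

lemma measurable_lastVisit (hT : Measurable T) (hYm : MeasurableSet Y) (n m : ℕ) :
    MeasurableSet {x | lastVisit T Y n x ≤ m} := by
  have : {x | lastVisit T Y n x ≤ m} = ⋂ i ∈ Finset.Ioc m n, (T^[i] ⁻¹' Y)ᶜ := by
    ext x
    simp only [Set.mem_ofPred_eq, lastVisit_le, Set.mem_iInter, Finset.mem_Ioc, Set.mem_compl_iff,
      Set.mem_preimage, and_imp]
  rw [this]
  exact Finset.measurableSet_biInter _ fun i _ => ((hT.iterate i) hYm).compl

lemma event_int (hT : Measurable T) (hYm : MeasurableSet Y) (H : X → ℝ≥0∞)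
    (hoff : ∀ᵐ x ∂μ, x ∉ Y → H x = 0) (N m : ℕ) (hmN : m < N) :
    ∫⁻ x in {x | lastVisit T Y N x ≤ m}, H x ∂μ =
      ∑ j ∈ Finset.range (m + 1), ∫⁻ x in T^[j] ⁻¹' Atail T Y (N - j), H x ∂μ := by
  have hm : ∀ j, MeasurableSet (T^[j] ⁻¹' Atail T Y (N - j)) := fun j =>
    (hT.iterate j) (measurable_Atail hT hYm _)
  have hkey : ∀ j j' x, j < j' → j' ≤ N → x ∈ T^[j] ⁻¹' Atail T Y (N - j) → T^[j'] x ∉ Y := by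
    intro j j' x hjj hj hx
    have h1 := (lt_firstReturn T Y (T^[j] x) (N - j)).1 hx.2 (j' - j) (by omega) (by omega)
    rwa [← Function.iterate_add_apply, Nat.sub_add_cancel hjj.le] at h1
  rw [← lintegral_biUnion_finset _ (fun j _ => hm j)]
  · set S := {x | lastVisit T Y N x ≤ m} with hS
    have hSm : MeasurableSet S := measurable_lastVisit hT hYm N m
    apply le_antisymm
    · rw [← int_Y H hYm hoff S hSm]
      apply lintegral_mono_set
      rintro x ⟨hxY, hx⟩
      have hb : BddAbove {k | k ≤ N ∧ T^[k] x ∈ Y} := ⟨N, fun k hk => hk.1⟩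
      have hmem : lastVisit T Y N x ∈ {k | k ≤ N ∧ T^[k] x ∈ Y} :=
        Nat.sSup_mem ⟨0, Nat.zero_le _, hxY⟩ hb
      refine Set.mem_biUnion (x := lastVisit T Y N x)
        (Finset.mem_coe.2 (Finset.mem_range.2 (Nat.lt_succ_of_le hx))) ?_
      refine ⟨hmem.2, (lt_firstReturn T Y _ _).2 ?_⟩
      intro i hi1 hi2
      rw [← Function.iterate_add_apply]
      exact (lastVisit_le T Y N _ x).1 le_rfl _ (by omega) (by have := hmem.1; omega)
    · apply lintegral_mono_set
      intro x hx
      obtain ⟨j, hj, hx⟩ := Set.mem_iUnion₂.1 hx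
      have hj' : j < m + 1 := Finset.mem_range.1 hj
      exact (lastVisit_le T Y N m x).2 fun i hi hiN => hkey j i x (by omega) hiN hx
  · intro j hj j' hj' hne
    have h1 : j < m + 1 := by simpa using hj
    have h2 : j' < m + 1 := by simpa using hj'
    refine Set.disjoint_left.2 fun x hx hx' => ?_
    rcases lt_or_gt_of_ne hne with h | h
    · exact hkey j j' x h (by omega) hx hx'.1
    · exact hkey j' j x h (by omega) hx' hx.1

lemma event_sandwich (hT : Measurable T) (hYm : MeasurableSet Y) (H : X → ℝ≥0∞)
    (hoff : ∀ᵐ x ∂μ, x ∉ Y → H x = 0)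
    (hfin : ∀ j i, (∫⁻ x in T^[i] ⁻¹' Atail T Y j, H x ∂μ) ≠ ⊤) (N m : ℕ) (hmN : m < N) :
    ∑ i ∈ Finset.range (m + 1), (∫⁻ x in T^[i] ⁻¹' Atail T Y N, H x ∂μ).toReal ≤
      (∫⁻ x in {x | lastVisit T Y N x ≤ m}, H x ∂μ).toReal ∧
    (∫⁻ x in {x | lastVisit T Y N x ≤ m}, H x ∂μ).toReal ≤
      ∑ i ∈ Finset.range (m + 1), (∫⁻ x in T^[i] ⁻¹' Atail T Y (N - m), H x ∂μ).toReal := by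
  rw [event_int hT hYm H hoff N m hmN, ENNReal.toReal_sum fun i _ => hfin _ _]
  constructor
  · apply Finset.sum_le_sum
    intro i hi
    apply ENNReal.toReal_mono (hfin _ _)
    exact lintegral_mono_set (Set.preimage_mono (Atail_anti T Y (by omega)))
  · apply Finset.sum_le_sum
    intro i hi
    have : i < m + 1 := by simpa using hi
    apply ENNReal.toReal_mono (hfin _ _)
    exact lintegral_mono_set (Set.preimage_mono (Atail_anti T Y (by omega)))

lemma shift_int {hatT : (X → ℝ≥0∞) → (X → ℝ≥0∞)} (hT : Measurable T) (hYm : MeasurableSet Y)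
    (hatTmeas : ∀ u, Measurable u → Measurable (hatT u))
    (hatTdual : ∀ u v : X → ℝ≥0∞, Measurable u → Measurable v →
      ∫⁻ x, v (T x) * u x ∂μ = ∫⁻ x, v x * hatT u x ∂μ) (H : X → ℝ≥0∞) (hHmeas : Measurable H)
    (k n : ℕ) (a : ℝ) (ha : 0 ≤ a) :
    ∫⁻ x in {x | (lastVisit T Y n x : ℝ) ≤ a}, (hatT^[k] H) x ∂μ =
      ∫⁻ x in {x | lastVisit T Y (n + k) x ≤ ⌊a⌋₊ + k}, H x ∂μ := by
  have h1 : {x | (lastVisit T Y n x : ℝ) ≤ a} = {x | lastVisit T Y n x ≤ ⌊a⌋₊} := by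
    ext x
    simp only [Set.mem_ofPred_eq, Nat.le_floor_iff ha]
  rw [h1, dual_set hT hatTmeas hatTdual k H hHmeas _ (measurable_lastVisit hT hYm n _)]
  congr 2
  ext x
  simp only [Set.mem_preimage, Set.mem_ofPred_eq, lastVisit_le, ← Function.iterate_add_apply]
  constructor
  · intro h i hi hin
    have := h (i - k) (by omega) (by omega)
    rwa [Nat.sub_add_cancel (by omega)] at this
  · intro h i hi hin
    exact h (i + k) (by omega) (by omega)

end dyn3

lemma kappa_eq (α : ℝ) (hα : α ∈ Set.Ioo (0:ℝ) 1) :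
    (1 - α) * (1 / (Real.Gamma (2 - α) * Real.Gamma (α + 1))) =
      Real.sin (Real.pi * α) / (Real.pi * α) := by
  obtain ⟨h0, h1⟩ := hα
  have e1 : Real.Gamma (2 - α) = (1 - α) * Real.Gamma (1 - α) := by
    rw [← Real.Gamma_add_one (by linarith : (1 - α) ≠ 0)]
    congr 1
    ring
  have e2 : Real.Gamma (α + 1) = α * Real.Gamma α := Real.Gamma_add_one h0.ne'
  have e3 := Real.Gamma_mul_Gamma_one_sub α
  have hs : 0 < Real.sin (Real.pi * α) :=
    Real.sin_pos_of_pos_of_lt_pi (by positivity) (by nlinarith [Real.pi_pos])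
  have hg : Real.Gamma α * Real.Gamma (1 - α) ≠ 0 :=
    (mul_pos (Real.Gamma_pos_of_pos h0) (Real.Gamma_pos_of_pos (by linarith))).ne'
  have h1' : (1 - α) ≠ 0 := by linarith
  have hpi := Real.pi_pos
  rw [e1, e2]
  have e4 : (1 - α) * (1 / ((1 - α) * Real.Gamma (1 - α) * (α * Real.Gamma α))) =
      1 / (α * (Real.Gamma α * Real.Gamma (1 - α))) := by
    have a1 := left_ne_zero_of_mul hg
    have a2 := right_ne_zero_of_mul hg
    field_simp
  rw [e4, e3]
  field_simp

set_option maxHeartbeats 2000000 in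
lemma final_limit (α : ℝ) (hα : α ∈ Set.Ioo (0:ℝ) 1)
    (ℓ : ℝ → ℝ) (hℓmeas : Measurable ℓ) (hℓpos : ∀ t, 0 < t → 0 < ℓ t)
    (hℓsv : ∀ lam : ℝ, 0 < lam → Tendsto (fun t => ℓ (lam * t) / ℓ t) atTop (𝓝 1))
    (q : ℕ → ℝ) (hq : Antitone q) (hq0 : ∀ n, 0 < q n)
    (w : ℕ → ℝ) (hwq : ∀ n, w n = ∑ k ∈ Finset.range n, q k)
    (hw : Tendsto (fun n : ℕ => w n / ((n : ℝ) ^ (1 - α) * ℓ n)) atTop (𝓝 1))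
    (p : ℕ → ℕ → ℝ) (M : ℝ) (hp0 : ∀ j i, 0 ≤ p j i) (hpM : ∀ j i, p j i ≤ M)
    (h : ∀ ε : ℝ, 0 < ε → ∃ D : ℝ, ∀ j N : ℕ,
      |∑ i ∈ Finset.range (N + 1), w (N - i + 1) * p j i - (N + 1)| ≤ ε * (N + 1) + D)
    (F : ℕ → ℕ → ℝ)
    (hF : ∀ N m, m < N → q N * ∑ i ∈ Finset.range (m + 1), p N i ≤ F N m ∧
      F N m ≤ q (N - m) * ∑ i ∈ Finset.range (m + 1), p (N - m) i)
    (k : ℕ) (c : ℕ → ℝ) (hc : ∀ n, 0 < c n) (hc0 : Tendsto c atTop (𝓝 0))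
    (hcn : Tendsto (fun n : ℕ => c n * n) atTop atTop) :
    Tendsto (fun n : ℕ => F (n + k) (⌊c n * n⌋₊ + k) /
      (Real.sin (Real.pi * α) / (Real.pi * α) * ((c n) ^ α * ℓ n / ℓ (c n * n)))) atTop (𝓝 1) := by
  have hα0 := hα.1
  have hα1 := hα.2
  have hwpos : ∀ n, 0 < n → 0 < w n := by
    intro n hn
    rw [hwq]
    exact Finset.sum_pos (fun k _ => hq0 k) (by simpa using hn.ne')
  have hr := w_ratio α ℓ hℓmeas hℓpos hℓsv w hw
  have hmd := mono_density α q hq w hwq hwpos hr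
  set N : ℕ → ℕ := fun n => n + k with hN
  set m : ℕ → ℕ := fun n => ⌊c n * n⌋₊ + k with hm
  have hNt : Tendsto N atTop atTop := tendsto_add_atTop_nat k
  have hmt : Tendsto m atTop atTop :=
    tendsto_atTop_mono (fun n => Nat.le_add_right _ k) (tendsto_nat_floor_atTop.comp hcn)
  have hmx : Tendsto (fun n => (m n : ℝ) / (c n * n)) atTop (𝓝 1) := by
    have a1 : Tendsto (fun n : ℕ => (⌊c n * n⌋₊ : ℝ) / (c n * n)) atTop (𝓝 1) :=
      (tendsto_nat_floor_div_atTop (R := ℝ)).comp hcn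
    have a2 : Tendsto (fun n : ℕ => (k : ℝ) / (c n * n)) atTop (𝓝 0) :=
      hcn.const_div_atTop _
    have := a1.add a2
    rw [add_zero] at this
    refine this.congr fun n => ?_
    simp only [hm]
    push_cast
    rw [add_div]
  have hNn : Tendsto (fun n : ℕ => (N n : ℝ) / (n : ℝ)) atTop (𝓝 1) := by
    have a2 : Tendsto (fun n : ℕ => (k : ℝ) / (n : ℝ)) atTop (𝓝 0) :=
      tendsto_natCast_atTop_atTop.const_div_atTop _
    have := a2.const_add 1
    rw [add_zero] at this
    refine this.congr' ?_
    filter_upwards [eventually_gt_atTop 0] with n hn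
    have : (n : ℝ) ≠ 0 := by positivity
    simp only [hN]
    push_cast
    field_simp
  have hnN : Tendsto (fun n : ℕ => (n : ℝ) / (N n : ℝ)) atTop (𝓝 1) := by
    have := hNn.inv₀ one_ne_zero
    rw [inv_one] at this
    exact this.congr fun n => inv_div _ _
  have hmN : Tendsto (fun n => (m n : ℝ) / (N n : ℝ)) atTop (𝓝 0) := by
    have := (hmx.mul hc0).mul hnN
    rw [mul_zero, zero_mul] at this
    refine this.congr' ?_
    filter_upwards [eventually_gt_atTop 0] with n hn
    have h1 : (n : ℝ) ≠ 0 := by positivity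
    have h2 := (hc n).ne'
    field_simp
  have hNpos : ∀ᶠ n in atTop, 0 < N n := hNt.eventually (eventually_gt_atTop 0)
  have hmpos : ∀ᶠ n in atTop, 0 < m n := hmt.eventually (eventually_gt_atTop 0)
  have hlt : ∀ᶠ n in atTop, m n < N n := by
    filter_upwards [hmN.eventually (gt_mem_nhds one_pos), hNpos] with n h1 h2
    rw [div_lt_one (by exact_mod_cast h2)] at h1
    exact_mod_cast h1
  set d : ℕ → ℕ := fun n => N n - m n with hd
  have hdN : Tendsto (fun n => (d n : ℝ) / (N n : ℝ)) atTop (𝓝 1) := by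
    have := hmN.const_sub 1
    rw [sub_zero] at this
    refine this.congr' ?_
    filter_upwards [hlt, hNpos] with n h1 h2
    have h3 : (N n : ℝ) ≠ 0 := by positivity
    simp only [hd]
    rw [Nat.cast_sub h1.le]
    field_simp
  have hNR : Tendsto (fun n => (N n : ℝ)) atTop atTop := tendsto_natCast_atTop_atTop.comp hNt
  have hmR : Tendsto (fun n => (m n : ℝ)) atTop atTop := tendsto_natCast_atTop_atTop.comp hmt
  have hdR : Tendsto (fun n => (d n : ℝ)) atTop atTop := by
    have := hdN.pos_mul_atTop one_pos hNR
    refine this.congr' ?_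
    filter_upwards [hNpos] with n h2
    have h3 : (N n : ℝ) ≠ 0 := by positivity
    field_simp
  have hdt : Tendsto d atTop atTop := tendsto_natCast_atTop_iff.1 hdR
  have hdpos : ∀ᶠ n in atTop, 0 < d n := hdt.eventually (eventually_gt_atTop 0)
  have hwd : Tendsto (fun n => w (d n) / w (N n)) atTop (𝓝 1) := by
    simpa using hr d N 1 one_pos hNt hdN
  set G := 1 / (Real.Gamma (2 - α) * Real.Gamma (α + 1)) with hG
  have hm't : Tendsto (fun n => max 1 (m n)) atTop atTop :=
    tendsto_atTop_mono (fun n => le_max_right _ _) hmt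
  have tb : ∀ s : ℕ → ℕ, Tendsto (fun n => (∑ i ∈ Finset.range (m n + 1), p (s n) i) *
      (w (m n) / m n)) atTop (𝓝 G) := by
    intro s
    have := tauber α hα q hq (fun n => (hq0 n).le) w hwq hwpos hr (fun n => p (s n))
      (fun n => max 1 (m n)) (fun n => lt_of_lt_of_le one_pos (le_max_left _ _)) hm't M
      (fun j i => hp0 _ _) (fun j i => hpM _ _) (by
        intro ε hε
        obtain ⟨D, hD⟩ := h ε hε
        exact ⟨D, fun j N => hD _ N⟩)
    refine this.congr' ?_
    filter_upwards [hmpos] with n hn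
    rw [max_eq_right (by omega : 1 ≤ m n)]
  set R : ℕ → ℝ := fun n => (m n / w (m n)) * (w (N n) / N n) with hR
  set κ := Real.sin (Real.pi * α) / (Real.pi * α) with hκ
  have hκG : (1 - α) * G = κ := kappa_eq α hα
  have hκpos : 0 < κ := by
    have hs : 0 < Real.sin (Real.pi * α) :=
      Real.sin_pos_of_pos_of_lt_pi (by positivity) (by nlinarith [Real.pi_pos])
    positivity
  have hFR : Tendsto (fun n => F (N n) (m n) / R n) atTop (𝓝 κ) := by
    have l1 := (hmd.comp hNt).mul (tb N)
    have l2 := (((hmd.comp hdt).mul hwd).mul (hdN.inv₀ one_ne_zero)).mul (tb d)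
    rw [hκG] at l1
    rw [inv_one, mul_one, mul_one, hκG] at l2
    refine tendsto_of_tendsto_of_tendsto_of_le_of_le' l1 l2 ?_ ?_
    · filter_upwards [hlt, hNpos, hmpos] with n h1 h2 h3
      have a1 := hwpos _ h2
      have a2 := hwpos _ h3
      have a3 : (0:ℝ) < N n := by exact_mod_cast h2
      have a4 : (0:ℝ) < m n := by exact_mod_cast h3
      have hRpos : 0 < R n := by simp only [hR]; positivity
      rw [le_div_iff₀ hRpos]
      refine le_trans (le_of_eq ?_) (hF (N n) (m n) h1).1
      simp only [hR, Function.comp]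
      field_simp
    · filter_upwards [hlt, hNpos, hmpos, hdpos] with n h1 h2 h3 h4
      have a1 := hwpos _ h2
      have a2 := hwpos _ h3
      have a3 : (0:ℝ) < N n := by exact_mod_cast h2
      have a4 : (0:ℝ) < m n := by exact_mod_cast h3
      have a5 := hwpos _ h4
      have a6 : (0:ℝ) < d n := by exact_mod_cast h4
      have hRpos : 0 < R n := by simp only [hR]; positivity
      rw [div_le_iff₀ hRpos]
      refine le_trans (hF (N n) (m n) h1).2 (le_of_eq ?_)
      change q (d n) * ∑ i ∈ Finset.range (m n + 1), p (d n) i = _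
      simp only [hR, Function.comp]
      field_simp
  have hRG : Tendsto (fun n : ℕ => R n / ((c n) ^ α * ℓ n / ℓ (c n * n))) atTop (𝓝 1) := by
    have A1 := hw.comp hNt
    have A2 := (hw.comp hmt).inv₀ one_ne_zero
    have A3' := hmx.mul hnN
    have A3 := A3'.rpow_const (p := α) (Or.inl (by norm_num))
    have A4 := sv_uct ℓ hℓmeas hℓpos hℓsv (fun n : ℕ => (n : ℝ)) (fun n => (N n : ℝ))
      tendsto_natCast_atTop_atTop hNn
    have A5 := (sv_uct ℓ hℓmeas hℓpos hℓsv (fun n : ℕ => c n * (n : ℝ)) (fun n => (m n : ℝ))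
      hcn hmx).inv₀ one_ne_zero
    have A := (((A1.mul A2).mul A3).mul A4).mul A5
    simp only [mul_one, inv_one, Real.one_rpow] at A
    refine A.congr' ?_
    filter_upwards [hNpos, hmpos, eventually_gt_atTop 0] with n h2 h3 h5
    have a1 := hwpos _ h2
    have a2 := hwpos _ h3
    have a3 : (0:ℝ) < N n := by exact_mod_cast h2
    have a4 : (0:ℝ) < m n := by exact_mod_cast h3
    have a5 : (0:ℝ) < n := by exact_mod_cast h5
    have a6 := hc n
    have b1 := hℓpos _ a3
    have b2 := hℓpos _ a4
    have b3 := hℓpos _ a5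
    have b4 := hℓpos _ (mul_pos a6 a5)
    simp only [hR, Function.comp]
    rw [Real.mul_rpow (by positivity) (by positivity), Real.div_rpow (by positivity)
      (by positivity), Real.div_rpow (by positivity) (by positivity),
      Real.mul_rpow (by positivity) (by positivity), Real.rpow_sub a3, Real.rpow_sub a4,
      Real.rpow_one, Real.rpow_one]
    have c1 := Real.rpow_pos_of_pos a3 α
    have c2 := Real.rpow_pos_of_pos a4 α
    have c3 := Real.rpow_pos_of_pos a5 α
    have c4 := Real.rpow_pos_of_pos a6 α
    generalize (N n : ℝ) ^ α = x1 at *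
    generalize (m n : ℝ) ^ α = x2 at *
    generalize (n : ℝ) ^ α = x3 at *
    generalize (c n) ^ α = x4 at *
    generalize ℓ (c n * n) = y1 at *
    generalize ℓ n = y2 at *
    generalize ℓ (N n) = y3 at *
    generalize ℓ (m n) = y4 at *
    generalize w (N n) = z1 at *
    generalize w (m n) = z2 at *
    field_simp
  have hfin := (hFR.mul hRG).div_const κ
  rw [mul_one, div_self hκpos.ne'] at hfin
  refine hfin.congr' ?_
  filter_upwards [hNpos, hmpos, eventually_gt_atTop 0] with n h2 h3 h5
  have a1 := hwpos _ h2
  have a2 := hwpos _ h3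
  have a3 : (0:ℝ) < N n := by exact_mod_cast h2
  have a4 : (0:ℝ) < m n := by exact_mod_cast h3
  have a5 : (0:ℝ) < n := by exact_mod_cast h5
  have b3 := hℓpos _ a5
  have b4 := hℓpos _ (mul_pos (hc n) a5)
  have c4 := Real.rpow_pos_of_pos (hc n) α
  have hRpos : 0 < R n := by simp only [hR]; positivity
  change _ = F (N n) (m n) / _
  generalize R n = r at *
  generalize F (N n) (m n) = f at *
  generalize (c n) ^ α = x4 at *
  generalize ℓ (c n * n) = y1 at *
  generalize ℓ n = y2 at *
  field_simp

/-- Large deviation estimate for the shifted initial distribution `μ_{T̂^k H}`: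
`μ_{T̂^k H}(Z_n^Y/n ≤ c(n)) ~ (sin πα)/(πα) · c(n)^α ℓ(n)/ℓ(c(n)n)`. -/
theorem stmt16 {X : Type*} [MeasurableSpace X] {μ : Measure X} [SigmaFinite μ]
    {T : X → X} (hcons : Conservative T μ) (herg : Ergodic T μ)
    (hinf : μ Set.univ = ⊤) {Y : Set X} (hYm : MeasurableSet Y)
    (hY0 : 0 < μ Y) (hY1 : μ Y < ⊤)
    (hatT : (X → ℝ≥0∞) → (X → ℝ≥0∞))
    (hatTmeas : ∀ u, Measurable u → Measurable (hatT u))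
    (hatTdual : ∀ u v : X → ℝ≥0∞, Measurable u → Measurable v →
      ∫⁻ x, v (T x) * u x ∂μ = ∫⁻ x, v x * hatT u x ∂μ)
    (α : ℝ) (hα : α ∈ Set.Ioo (0:ℝ) 1)
    (ℓ : ℝ → ℝ) (hℓmeas : Measurable ℓ) (hℓpos : ∀ t, 0 < t → 0 < ℓ t)
    (hℓsv : ∀ lam : ℝ, 0 < lam → Tendsto (fun t => ℓ (lam * t) / ℓ t) atTop (𝓝 1))
    -- (A2): `w_n^Y ~ n^{1-α} ℓ(n)`
    (hw : Tendsto (fun n : ℕ => (wrate T Y μ n).toReal / ((n : ℝ) ^ (1 - α) * ℓ n))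
      atTop (𝓝 1))
    -- (A3): uniform sweeping of the entrance densities for `1_Y`
    (hA3 : ∃ (N : ℕ) (C : ℝ≥0∞) (K : ℕ), C ≠ ⊤ ∧ ∀ n : ℕ, N ≤ n →
      ∀ᵐ x ∂μ.restrict Y,
        1 ≤ C * ∑ j ∈ Finset.range (K + 1), (hatT^[j] (entrance T Y μ hatT n)) x)
    -- (A4): `L^∞` convergence of the entrance densities to `H`
    (H : X → ℝ≥0∞) (hHmeas : Measurable H)
    (hHbd : ∃ M : ℝ≥0∞, M ≠ ⊤ ∧ ∀ᵐ x ∂μ, H x ≤ M)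
    (hA4 : ∀ ε : ℝ≥0∞, 0 < ε → ∀ᶠ n : ℕ in atTop, ∀ᵐ x ∂μ,
      entrance T Y μ hatT n x ≤ H x + ε ∧ H x ≤ entrance T Y μ hatT n x + ε) :
    ∀ k : ℕ, ∀ c : ℕ → ℝ, (∀ n, 0 < c n) → Tendsto c atTop (𝓝 0) →
      Tendsto (fun n : ℕ => c n * n) atTop atTop →
      Tendsto (fun n : ℕ =>
        (∫⁻ x in {x | (lastVisit T Y n x : ℝ) ≤ c n * n}, (hatT^[k] H) x ∂μ).toReal /
          (Real.sin (Real.pi * α) / (Real.pi * α) * ((c n) ^ α * ℓ n / ℓ (c n * n))))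
        atTop (𝓝 1) := by
  intro k c hc hc0 hcn
  have hT : MeasurePreserving T μ μ := herg.toMeasurePreserving
  have hAfin : ∀ j, μ (Atail T Y j) ≠ ⊤ := fun j =>
    ((measure_mono (Atail_sub T Y j)).trans_lt hY1).ne
  have hqanti : Antitone fun n => (μ (Atail T Y n)).toReal := fun a b hab =>
    ENNReal.toReal_mono (hAfin a) (measure_mono (Atail_anti T Y hab))
  have hA0 : Atail T Y 0 = Y := by
    ext x
    refine ⟨fun h => h.1, fun h => ⟨h, (lt_firstReturn T Y x 0).2 fun i h1 h2 => ?_⟩⟩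
    omega
  have hwq : ∀ n, (wrate T Y μ n).toReal = ∑ k ∈ Finset.range n, (μ (Atail T Y k)).toReal :=
    fun n => wrate_eq n hY1
  have hwpos : ∀ n, 0 < n → 0 < (wrate T Y μ n).toReal := by
    intro n hn
    rw [hwq]
    refine Finset.sum_pos' (fun k _ => ENNReal.toReal_nonneg) ⟨0, by simpa using hn, ?_⟩
    rw [hA0]
    exact ENNReal.toReal_pos hY0.ne' hY1.ne
  have hr := w_ratio α ℓ hℓmeas hℓpos hℓsv (fun n => (wrate T Y μ n).toReal) hw
  have hmd := mono_density α _ hqanti _ hwq hwpos hr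
  have hqpos : ∀ n, 0 < (μ (Atail T Y n)).toReal := by
    intro n
    have h1 := hmd.eventually (lt_mem_nhds (show (0:ℝ) < 1 - α by linarith [hα.2]))
    obtain ⟨j, hj, hnj⟩ := (h1.and (eventually_ge_atTop n)).exists
    refine lt_of_lt_of_le ?_ (hqanti hnj)
    rcases (ENNReal.toReal_nonneg (a := μ (Atail T Y j))).lt_or_eq with h | h
    · exact h
    · rw [← h] at hj
      simp at hj
  obtain ⟨M, hfin, hpM, hbd⟩ := renewal_bound hT hYm hY1 hatT hatTmeas hatTdual hA3 H hHmeas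
    hHbd hA4 hqpos
  have hoff := H_off hT.measurable hYm hatTmeas hatTdual H hA4
  have key := final_limit α hα ℓ hℓmeas hℓpos hℓsv _ hqanti hqpos _ hwq hw
    (fun j i => (∫⁻ x in T^[i] ⁻¹' Atail T Y j, H x ∂μ).toReal / (μ (Atail T Y j)).toReal) M
    (fun j i => by positivity) hpM hbd
    (fun N m => (∫⁻ x in {x | lastVisit T Y N x ≤ m}, H x ∂μ).toReal)
    (by
      intro N m hmN
      have := event_sandwich hT.measurable hYm H hoff hfin N m hmN
      rw [← Finset.sum_div, ← Finset.sum_div, mul_div_cancel₀ _ (hqpos _).ne',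
        mul_div_cancel₀ _ (hqpos _).ne']
      exact this) k c hc hc0 hcn
  refine key.congr fun n => ?_
  rw [shift_int hT.measurable hYm hatTmeas hatTdual H hHmeas k n (c n * n)
    (mul_nonneg (hc n).le (Nat.cast_nonneg n))]
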